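/- arXiv:1710.11312 — 5 statements merged into one kernel-verified Lean document; each statement's English description precedes it below -/
import Mathlib

section
/- Let s₀ ∈ (0,1) and let L ∈ C⁰([0,s₀)) ∩ C¹((0,s₀)) be positive and nondecreasing on (0,s₀) and satisfy hypothesis (H) for s₀ with constants a>0 and λ₀>0. Then s·L'(s)/L(s) ≤ a/ln(1/s) for all s ∈ (0,s₀); in particular s·L'(s)/L(s) → 0 as s ↘ 0. -/
open Real Set Filter

theorem aux_right {f : ℝ → ℝ} {f' x : ℝ} (hf : HasDerivAt f f' x)
    (h : ∀ᶠ y in nhdsWithin x (Set.Ioi x), f x ≤ f y) : 0 ≤ f' := by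
  have h1 := hasDerivWithinAt_iff_tendsto_slope' (s := Set.Ioi x) (by simp) |>.1
    (hf.hasDerivWithinAt (s := Set.Ioi x))
  refine ge_of_tendsto h1 ?_
  filter_upwards [h, self_mem_nhdsWithin] with y hy hxy
  have hxy' : x < y := hxy
  rw [slope_def_field]
  exact div_nonneg (by linarith) (by linarith)

/-- Lemma 2.1 of Fila–Winkler.
If `s₀ ∈ (0,1)` and `L ∈ C⁰([0,s₀)) ∩ C¹((0,s₀))` is positive and nondecreasing on `(0,s₀)`
and satisfies hypothesis (H) with constants `a, λ₀ > 0`, then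
`s·L'(s)/L(s) ≤ a / ln(1/s)` on `(0,s₀)`, and in particular `s·L'(s)/L(s) → 0` as `s ↘ 0`. -/
theorem stmt_1 (s₀ : ℝ) (hs₀ : s₀ ∈ Set.Ioo (0:ℝ) 1)
    (L L' : ℝ → ℝ)
    (hLcont : ContinuousOn L (Set.Ico 0 s₀))
    (hLderiv : ∀ s ∈ Set.Ioo 0 s₀, HasDerivAt L (L' s) s)
    (hL'cont : ContinuousOn L' (Set.Ioo 0 s₀))
    (hLpos : ∀ s ∈ Set.Ioo 0 s₀, 0 < L s)
    (hLmono : MonotoneOn L (Set.Ioo 0 s₀))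
    (a lam₀ : ℝ) (ha : 0 < a) (hlam₀ : 0 < lam₀)
    (hH : ∀ s ∈ Set.Ioo 0 s₀, ∀ l ∈ Set.Ioo 0 lam₀,
      L s ≤ (1 + a * l) * L (s ^ (1 + l))) :
    (∀ s ∈ Set.Ioo 0 s₀, s * L' s / L s ≤ a / Real.log (1 / s)) ∧
    Filter.Tendsto (fun s => s * L' s / L s) (nhdsWithin 0 (Set.Ioi 0)) (nhds 0) := by
  have key : ∀ s ∈ Set.Ioo 0 s₀, s * L' s / L s ≤ a / Real.log (1 / s) := by
    intro s hs
    have hs0 : 0 < s := hs.1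
    have hs1 : s < 1 := hs.2.trans hs₀.2
    have hlog : 0 < -Real.log s := by linarith [Real.log_neg hs0 hs1]
    have e0 : s ^ (1 + (0:ℝ)) = s := by simp
    have hpow : HasDerivAt (fun l : ℝ => s ^ (1 + l)) (s * Real.log s) 0 := by
      have := ((hasDerivAt_id (0:ℝ)).const_add 1).const_rpow hs0
      simp only [id] at this
      rw [e0] at this
      convert this using 1
      ring
    have hL : HasDerivAt L (L' s) (s ^ (1 + (0:ℝ))) := by
      rw [e0]; exact hLderiv s hs
    have hcomp : HasDerivAt (fun l : ℝ => L (s ^ (1 + l))) (L' s * (s * Real.log s)) 0 :=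
      HasDerivAt.comp (0:ℝ) hL hpow
    have hlin : HasDerivAt (fun l : ℝ => 1 + a * l) a 0 := by
      simpa using ((hasDerivAt_id (0:ℝ)).const_mul a).const_add 1
    have hF := hlin.mul hcomp
    have h0 := aux_right hF (by
      filter_upwards [Ioo_mem_nhdsGT hlam₀] with l hl
      have := hH s hs l hl
      simpa using this)
    simp only [mul_zero, add_zero, one_mul, Real.rpow_one] at h0
    rw [one_div, Real.log_inv, div_le_div_iff₀ (hLpos s hs) hlog]
    linarith
  refine ⟨key, ?_⟩
  have hmem : Set.Ioo 0 s₀ ∈ nhdsWithin (0:ℝ) (Set.Ioi 0) := Ioo_mem_nhdsGT hs₀.1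
  have hlim : Filter.Tendsto (fun s : ℝ => a / Real.log (1 / s))
      (nhdsWithin 0 (Set.Ioi 0)) (nhds 0) := by
    apply Filter.Tendsto.div_atTop tendsto_const_nhds
    simp only [one_div]
    exact Real.tendsto_log_atTop.comp tendsto_inv_nhdsGT_zero
  refine tendsto_of_tendsto_of_tendsto_of_le_of_le' tendsto_const_nhds hlim ?_ ?_
  · filter_upwards [hmem] with s hs
    have : 0 ≤ L' s := aux_right (hLderiv s hs) (by
      filter_upwards [Ioo_mem_nhdsGT hs.2] with y hy
      exact hLmono hs ⟨hs.1.trans hy.1, hy.2⟩ hy.1.le)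
    exact div_nonneg (mul_nonneg hs.1.le this) (hLpos s hs).le
  · filter_upwards [hmem] with s hs using key s hs
end

section
/- Let s₀ ∈ (0,1) and let L ∈ C⁰([0,s₀)) ∩ C¹((0,s₀)) be positive and nondecreasing on (0,s₀) and satisfy hypothesis (H) for s₀. Then for any d ∈ (0,1) there exists a constant C>0 such that L(d·s) ≥ C·L(s) for all s ∈ (0,s₀). -/
open Real Set

/-- Lemma 2.2 of Fila–Winkler.
If `s₀ ∈ (0,1)` and `L ∈ C⁰([0,s₀)) ∩ C¹((0,s₀))` is positive and nondecreasing on `(0,s₀)`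
and satisfies hypothesis (H), then for every `d ∈ (0,1)` there is `C > 0` with
`L(d·s) ≥ C·L(s)` for all `s ∈ (0,s₀)`. -/
theorem stmt_2 (s₀ : ℝ) (hs₀ : s₀ ∈ Set.Ioo (0:ℝ) 1)
    (L L' : ℝ → ℝ)
    (hLcont : ContinuousOn L (Set.Ico 0 s₀))
    (hLderiv : ∀ s ∈ Set.Ioo 0 s₀, HasDerivAt L (L' s) s)
    (hL'cont : ContinuousOn L' (Set.Ioo 0 s₀))
    (hLpos : ∀ s ∈ Set.Ioo 0 s₀, 0 < L s)
    (hLmono : MonotoneOn L (Set.Ioo 0 s₀))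
    (hH : ∃ a > 0, ∃ lam₀ > 0, ∀ s ∈ Set.Ioo 0 s₀, ∀ l ∈ Set.Ioo 0 lam₀,
      L s ≤ (1 + a * l) * L (s ^ (1 + l))) :
    ∀ d ∈ Set.Ioo (0:ℝ) 1, ∃ C > 0, ∀ s ∈ Set.Ioo 0 s₀, C * L s ≤ L (d * s) := by
  obtain ⟨a, ha, lam₀, hlam, H⟩ := hH
  rintro d ⟨hd0, hd1⟩
  obtain ⟨h0, h1⟩ := hs₀
  obtain ⟨l, hl0, hl1⟩ : ∃ l : ℝ, 0 < l ∧ l < lam₀ := ⟨lam₀ / 2, by linarith, by linarith⟩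
  have hK : 0 < 1 + a * l := by positivity
  have iter : ∀ n : ℕ, ∀ s ∈ Set.Ioo 0 s₀,
      s ^ ((1 + l) ^ n : ℝ) ∈ Set.Ioo 0 s₀ ∧ L s ≤ (1 + a * l) ^ n * L (s ^ ((1 + l) ^ n : ℝ)) := by
    intro n s hs
    induction n with
    | zero => simpa using hs
    | succ n ih =>
      obtain ⟨hm, hle⟩ := ih
      have e : s ^ ((1 + l) ^ (n + 1) : ℝ) = (s ^ ((1 + l) ^ n : ℝ)) ^ (1 + l) := by
        rw [← Real.rpow_mul hs.1.le, pow_succ]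
      have h2 := H _ hm l ⟨hl0, hl1⟩
      rw [e]
      refine ⟨⟨Real.rpow_pos_of_pos hm.1 _, lt_of_le_of_lt ?_ hm.2⟩, ?_⟩
      · have := Real.rpow_le_rpow_of_exponent_ge hm.1 (hm.2.trans h1).le
          (show (1 : ℝ) ≤ 1 + l by linarith)
        rwa [Real.rpow_one] at this
      · calc _ ≤ _ := hle
          _ ≤ (1 + a * l) ^ n * ((1 + a * l) * L ((s ^ ((1 + l) ^ n : ℝ)) ^ (1 + l))) := by gcongr
          _ = _ := by ring
  obtain ⟨m, hm⟩ := exists_pow_lt_of_lt_one hd0 h1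
  obtain ⟨n, hn⟩ := pow_unbounded_of_one_lt ((m : ℝ) + 1) (show 1 < 1 + l by linarith)
  refine ⟨((1 + a * l) ^ n)⁻¹, by positivity, fun s hs => ?_⟩
  obtain ⟨hm1, hle⟩ := iter n s hs
  have hs0 : 0 < s := hs.1
  have hs1 : s < s₀ := hs.2
  have hds : d * s ∈ Set.Ioo 0 s₀ := ⟨by positivity, by nlinarith⟩
  have key : s ^ ((1 + l) ^ n : ℝ) ≤ d * s := by
    calc s ^ ((1 + l) ^ n : ℝ) ≤ s ^ ((m : ℝ) + 1) :=
          Real.rpow_le_rpow_of_exponent_ge hs0 (hs1.trans h1).le hn.le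
      _ = s ^ m * s := by rw [Real.rpow_add_one hs0.ne', Real.rpow_natCast]
      _ ≤ s₀ ^ m * s := by gcongr
      _ ≤ d * s := by gcongr
  rw [inv_mul_le_iff₀ (by positivity)]
  exact hle.trans (mul_le_mul_of_nonneg_left (hLmono hm1 hds key) (by positivity))
end

section
/- Let s₀ ∈ (0,1) and let L ∈ C⁰([0,∞)) ∩ C¹((0,s₀)) be nonnegative, nondecreasing, and satisfy hypothesis (H) for s₀, with L positive on (0,∞). Then for any n ≥ 1, q⋆ > 0, q ∈ (0,q⋆) and K > 0 there exists C = C(n,q,q⋆,K) > 0 with the property: if φ ∈ L^{q⋆}(ℝⁿ) is nonnegative, not identically zero, and satisfies ∫_{ℝⁿ} L(φ(x)) dx ≤ K, then ‖φ‖_{L^q(ℝⁿ)} ≤ C · ‖φ‖_{L^{q⋆}(ℝⁿ)} · ( L(‖φ‖²_{L^{q⋆}(ℝⁿ)})^{−(1/q − 1/q⋆)} + 1 ). -/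
open Real Set MeasureTheory

lemma aux_deriv (s₀ : ℝ) (hs₀ : s₀ ∈ Set.Ioo (0:ℝ) 1) (L L' : ℝ → ℝ)
    (hLderiv : ∀ s ∈ Set.Ioo 0 s₀, HasDerivAt L (L' s) s)
    (a lam₀ : ℝ) (hl0 : 0 < lam₀)
    (hH : ∀ s ∈ Set.Ioo 0 s₀, ∀ l ∈ Set.Ioo 0 lam₀, L s ≤ (1 + a * l) * L (s ^ (1 + l)))
    (s : ℝ) (hs : s ∈ Set.Ioo 0 s₀) : 0 ≤ a * L s + L' s * (s * Real.log s) := by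
  have hp : HasDerivAt (fun l : ℝ => s ^ (1 + l)) (s * Real.log s) 0 := by
    have h1 : HasDerivAt (fun l : ℝ => 1 + l) 1 0 := (hasDerivAt_id 0).const_add 1
    have := h1.const_rpow hs.1
    convert this using 1
    simp; ring
  have hL1 : HasDerivAt (fun l : ℝ => L (s ^ (1 + l))) (L' s * (s * Real.log s)) 0 := by
    have h2 : HasDerivAt L (L' s) (s ^ ((1:ℝ) + 0)) := by simpa using hLderiv s hs
    exact HasDerivAt.comp (0:ℝ) h2 hp
  have ha : HasDerivAt (fun l : ℝ => 1 + a * l) a 0 := by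
    simpa using ((hasDerivAt_id (0:ℝ)).const_mul a).const_add 1
  have hg := ha.mul hL1
  have hg2 : HasDerivAt (fun l : ℝ => (1 + a * l) * L (s ^ (1 + l)))
      (a * L s + L' s * (s * Real.log s)) 0 := by
    exact hg.congr_deriv (by simp)
  have ht := (hasDerivAt_iff_tendsto_slope.1 hg2).mono_left
    (nhdsWithin_mono (0:ℝ) (show Set.Ioi (0:ℝ) ⊆ {0}ᶜ from fun x hx => ne_of_gt hx))
  refine ge_of_tendsto ht ?_
  filter_upwards [Ioo_mem_nhdsGT hl0] with l hl
  rw [slope_def_field]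
  have := hH s hs l hl
  apply div_nonneg
  · simpa using this
  · linarith [hl.1]

lemma aux_mono (s₀ : ℝ) (hs₀ : s₀ ∈ Set.Ioo (0:ℝ) 1) (L L' : ℝ → ℝ)
    (hLderiv : ∀ s ∈ Set.Ioo 0 s₀, HasDerivAt L (L' s) s)
    (hLpos : ∀ s ∈ Set.Ioi (0:ℝ), 0 < L s)
    (a lam₀ : ℝ) (ha : 0 < a) (hl0 : 0 < lam₀)
    (hH : ∀ s ∈ Set.Ioo 0 s₀, ∀ l ∈ Set.Ioo 0 lam₀, L s ≤ (1 + a * l) * L (s ^ (1 + l)))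
    (b : ℝ) (hb : 0 < b) (s₁ : ℝ) (h1 : s₁ < s₀) (h2 : s₁ ≤ Real.exp (-(a / b))) :
    MonotoneOn (fun s => s ^ b / L s) (Set.Ioc 0 s₁) := by
  have key : ∀ s ∈ Set.Ioc 0 s₁, HasDerivAt (fun s => s ^ b / L s)
      ((b * s ^ (b - 1) * L s - s ^ b * L' s) / L s ^ 2) s := by
    intro s hs
    exact (Real.hasDerivAt_rpow_const (Or.inl hs.1.ne')).div
      (hLderiv s ⟨hs.1, hs.2.trans_lt h1⟩) (hLpos s hs.1).ne'
  apply monotoneOn_of_deriv_nonneg (convex_Ioc 0 s₁)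
  · intro s hs
    exact (key s hs).continuousAt.continuousWithinAt
  · intro s hs
    exact (key s (interior_subset hs)).differentiableAt.differentiableWithinAt
  · intro s hs
    have hs := interior_subset hs
    rw [(key s hs).deriv]
    have hs0 := hs.1
    have hd := aux_deriv s₀ hs₀ L L' hLderiv a lam₀ hl0 hH s ⟨hs.1, hs.2.trans_lt h1⟩
    have hlog : Real.log s ≤ -(a / b) := by
      rw [Real.log_le_iff_le_exp hs0]; exact hs.2.trans h2
    have hab : 0 < a / b := by positivity
    have hLs := hLpos s hs0
    have hmain : s * L' s ≤ b * L s := by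
      by_contra hc
      push Not at hc
      have : s * L' s * Real.log s ≤ s * L' s * (-(a / b)) :=
        mul_le_mul_of_nonneg_left hlog (by nlinarith [mul_pos hb hLs])
      have h4 : b * L s * (a / b) < s * L' s * (a / b) := mul_lt_mul_of_pos_right hc hab
      have h5 : b * L s * (a / b) = a * L s := by field_simp
      nlinarith
    have e : s ^ b = s ^ (b - 1) * s := by
      rw [Real.rpow_sub_one hs0.ne']; field_simp
    rw [e]
    have hp : 0 < s ^ (b - 1) := Real.rpow_pos_of_pos hs0 _
    apply div_nonneg _ (sq_nonneg _)
    nlinarith [mul_le_mul_of_nonneg_left hmain hp.le]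

lemma aux_pt (L : ℝ → ℝ)
    (hLnonneg : ∀ s ∈ Set.Ici (0:ℝ), 0 ≤ L s)
    (hLpos : ∀ s ∈ Set.Ioi (0:ℝ), 0 < L s)
    (hLmono : MonotoneOn L (Set.Ici 0))
    (q qs s₁ d R c : ℝ) (hq : 0 < q) (hqs : q < qs)
    (hm : MonotoneOn (fun s => s ^ q / L s) (Set.Ioc 0 s₁))
    (hd : 0 < d) (hds : d ≤ s₁) (hR : 0 < R) (hc : 0 ≤ c) :
    c ^ q ≤ (R ^ q / L d + d ^ q / L d) * L c + R ^ (q - qs) * c ^ qs := by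
  have hLd := hLpos d hd
  have hLc := hLnonneg c hc
  have t1 : 0 ≤ R ^ q / L d := by positivity
  have t2 : 0 ≤ d ^ q / L d := by positivity
  have t3 : 0 ≤ R ^ (q - qs) * c ^ qs := by positivity
  rcases hc.eq_or_lt with h0 | h0
  · have e : c ^ q = 0 := by rw [← h0, Real.zero_rpow hq.ne']
    rw [e]
    exact add_nonneg (mul_nonneg (add_nonneg t1 t2) hLc) t3
  have hLc' := hLpos c h0
  rcases lt_or_ge c d with h | h
  · have := hm ⟨h0, h.le.trans hds⟩ ⟨hd, hds⟩ h.le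
    simp only at this
    rw [div_le_iff₀ hLc'] at this
    nlinarith [mul_nonneg t1 hLc]
  · have hL := hLmono (show d ∈ Set.Ici 0 from hd.le) (show c ∈ Set.Ici 0 from hc) h
    rcases le_or_gt c R with h' | h'
    · have a1 : c ^ q ≤ R ^ q := Real.rpow_le_rpow hc h' hq.le
      have a2 : R ^ q ≤ R ^ q / L d * L c := by
        rw [div_mul_eq_mul_div, le_div_iff₀ hLd]
        exact mul_le_mul_of_nonneg_left hL (by positivity)
      nlinarith [mul_nonneg t2 hLc]
    · have a1 : c ^ q = c ^ (q - qs) * c ^ qs := by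
        rw [← Real.rpow_add h0]; congr 1; ring
      have a2 : c ^ (q - qs) ≤ R ^ (q - qs) :=
        Real.rpow_le_rpow_of_nonpos hR h'.le (by linarith)
      have a3 : c ^ q ≤ R ^ (q - qs) * c ^ qs := by
        rw [a1]; exact mul_le_mul_of_nonneg_right a2 (by positivity)
      nlinarith [mul_nonneg t1 hLc, mul_nonneg t2 hLc]

/-- the scalar estimate -/
lemma aux_scalar (q qs K N d l B : ℝ) (hq : 0 < q) (hqs : q < qs) (hK : 0 < K)
    (hN : 0 < N) (hd : 0 < d) (hdN : d ≤ N ^ (2:ℝ)) (hl : 0 < l) (hB : 0 < B)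
    (hdB : d ^ (qs / 2) ≤ B * l) (I : ℝ) (hI0 : 0 ≤ I)
    (hI : I ≤ ((N * l ^ (1 / qs)) ^ q / l + d ^ q / l) * K
      + (N * l ^ (1 / qs)) ^ (q - qs) * N ^ qs) :
    I ^ (1 / q) ≤ (K + 1 + K * B ^ (q / qs)) ^ (1 / q) * N * l ^ (-(1 / q - 1 / qs)) := by
  have hqs0 : 0 < qs := hq.trans hqs
  have e1 : (N * l ^ (1 / qs)) ^ q / l = N ^ q * l ^ (q / qs - 1) := by
    rw [Real.mul_rpow hN.le (by positivity), ← Real.rpow_mul hl.le, Real.rpow_sub_one hl.ne']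
    rw [mul_div_assoc]; congr 3; ring
  have e2 : (N * l ^ (1 / qs)) ^ (q - qs) * N ^ qs = N ^ q * l ^ (q / qs - 1) := by
    rw [Real.mul_rpow hN.le (by positivity), ← Real.rpow_mul hl.le, mul_right_comm,
      ← Real.rpow_add hN]
    congr 2
    · ring
    · field_simp
  have e3 : d ^ q / l ≤ B ^ (q / qs) * (N ^ q * l ^ (q / qs - 1)) := by
    have h1 : d ^ (1 / 2 : ℝ) ≤ N := by
      calc d ^ (1 / 2 : ℝ) ≤ (N ^ (2:ℝ)) ^ (1 / 2 : ℝ) :=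
            Real.rpow_le_rpow hd.le hdN (by norm_num)
        _ = N := by rw [← Real.rpow_mul hN.le]; norm_num
    have h2 : d ^ (q / 2) ≤ N ^ q := by
      calc d ^ (q / 2) = (d ^ (1 / 2 : ℝ)) ^ q := by
            rw [← Real.rpow_mul hd.le]; congr 1; ring
        _ ≤ N ^ q := Real.rpow_le_rpow (by positivity) h1 hq.le
    have h3 : d ^ (q / 2) ≤ B ^ (q / qs) * l ^ (q / qs) := by
      calc d ^ (q / 2) = (d ^ (qs / 2)) ^ (q / qs) := by
            rw [← Real.rpow_mul hd.le]; congr 1; field_simp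
        _ ≤ (B * l) ^ (q / qs) := Real.rpow_le_rpow (by positivity) hdB (by positivity)
        _ = _ := Real.mul_rpow hB.le hl.le
    have h4 : d ^ q = d ^ (q / 2) * d ^ (q / 2) := by
      rw [← Real.rpow_add hd]; congr 1; ring
    rw [Real.rpow_sub_one hl.ne', h4]
    calc d ^ (q / 2) * d ^ (q / 2) / l ≤ N ^ q * (B ^ (q / qs) * l ^ (q / qs)) / l := by gcongr
      _ = _ := by ring
  rw [e1, e2] at hI
  have hI2 : I ≤ (K + 1 + K * B ^ (q / qs)) * (N ^ q * l ^ (q / qs - 1)) := by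
    nlinarith [mul_le_mul_of_nonneg_right e3 hK.le]
  calc I ^ (1 / q) ≤ ((K + 1 + K * B ^ (q / qs)) * (N ^ q * l ^ (q / qs - 1))) ^ (1 / q) :=
        Real.rpow_le_rpow hI0 hI2 (by positivity)
    _ = _ := by
      rw [Real.mul_rpow (by positivity) (by positivity),
        Real.mul_rpow (by positivity) (by positivity), ← Real.rpow_mul hN.le,
        ← Real.rpow_mul hl.le, mul_one_div_cancel hq.ne', Real.rpow_one, mul_assoc]
      congr 3
      field_simp
      ring

/-- Lemma 2.3 of Fila–Winkler, interpolation in Lebesgue spaces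
for rapidly decaying functions.
Let `s₀ ∈ (0,1)` and let `L ∈ C⁰([0,∞)) ∩ C¹((0,s₀))` be nonnegative, nondecreasing,
positive on `(0,∞)`, and satisfy hypothesis (H).  Then for any `n ≥ 1`, `q⋆ > 0`,
`q ∈ (0,q⋆)` and `K > 0` there is `C > 0` such that every nonnegative `0 ≢ φ ∈ L^{q⋆}(ℝⁿ)`
with `∫ L(φ) ≤ K` satisfies
`‖φ‖_{L^q} ≤ C ‖φ‖_{L^{q⋆}} (L(‖φ‖_{L^{q⋆}}²)^{-(1/q-1/q⋆)} + 1)`,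
where `‖φ‖_{L^r} = (∫ |φ|^r)^{1/r}`. -/
theorem stmt_3 (s₀ : ℝ) (hs₀ : s₀ ∈ Set.Ioo (0:ℝ) 1)
    (L L' : ℝ → ℝ)
    (hLcont : ContinuousOn L (Set.Ici 0))
    (hLderiv : ∀ s ∈ Set.Ioo 0 s₀, HasDerivAt L (L' s) s)
    (hL'cont : ContinuousOn L' (Set.Ioo 0 s₀))
    (hLnonneg : ∀ s ∈ Set.Ici (0:ℝ), 0 ≤ L s)
    (hLpos : ∀ s ∈ Set.Ioi (0:ℝ), 0 < L s)
    (hLmono : MonotoneOn L (Set.Ici 0))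
    (hH : ∃ a > 0, ∃ lam₀ > 0, ∀ s ∈ Set.Ioo 0 s₀, ∀ l ∈ Set.Ioo 0 lam₀,
      L s ≤ (1 + a * l) * L (s ^ (1 + l)))
    (n : ℕ) (hn : 1 ≤ n) (qs q K : ℝ) (hqs : 0 < qs) (hq : q ∈ Set.Ioo 0 qs) (hK : 0 < K) :
    ∃ C > 0, ∀ φ : EuclideanSpace ℝ (Fin n) → ℝ,
      (∀ x, 0 ≤ φ x) → φ ≠ 0 →
      AEStronglyMeasurable φ volume →
      Integrable (fun x => φ x ^ qs) volume →
      Integrable (fun x => L (φ x)) volume →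
      (∫ x, L (φ x)) ≤ K →
      (∫ x, φ x ^ q) ^ (1 / q) ≤
        C * (∫ x, φ x ^ qs) ^ (1 / qs) *
          (L (((∫ x, φ x ^ qs) ^ (1 / qs)) ^ (2:ℝ)) ^ (-(1 / q - 1 / qs)) + 1) := by

  obtain ⟨a, ha, lam₀, hl0, hH⟩ := hH
  obtain ⟨hq0, hqqs⟩ := hq
  obtain ⟨s₁, hs1, hs10, hs1q, hs1qs⟩ : ∃ s₁ : ℝ, 0 < s₁ ∧ s₁ < s₀ ∧
      s₁ ≤ Real.exp (-(a / q)) ∧ s₁ ≤ Real.exp (-(a / (qs / 2))) := by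
    have := hs₀.1
    refine ⟨min (s₀ / 2) (min (Real.exp (-(a / q))) (Real.exp (-(a / (qs / 2))))), ?_, ?_, ?_, ?_⟩
    · positivity
    · exact (min_le_left _ _).trans_lt (by linarith)
    · exact (min_le_right _ _).trans (min_le_left _ _)
    · exact (min_le_right _ _).trans (min_le_right _ _)
  have hm1 := aux_mono s₀ hs₀ L L' hLderiv hLpos a lam₀ ha hl0 hH q hq0 s₁ hs10 hs1q
  have hm2 := aux_mono s₀ hs₀ L L' hLderiv hLpos a lam₀ ha hl0 hH (qs / 2) (by positivity)
    s₁ hs10 hs1qs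
  have hL1 := hLpos s₁ hs1
  set B : ℝ := s₁ ^ (qs / 2) / L s₁ with hBdef
  have hB : 0 < B := by positivity
  set D : ℝ := (K + 1 + K * B ^ (q / qs)) ^ (1 / q) with hD
  have hDpos : 0 < D := by positivity
  set m : ℝ := 1 / q - 1 / qs with hm
  have hmpos : 0 < m := by
    have := one_div_lt_one_div_of_lt hq0 hqqs
    linarith
  refine ⟨D * (1 + L s₁ ^ (-m)), by positivity, ?_⟩
  intro φ hφ0 _ _ hiq hiL hLK
  have hJ : 0 ≤ ∫ x, φ x ^ qs := integral_nonneg fun x => Real.rpow_nonneg (hφ0 x) _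
  rcases hJ.eq_or_lt with hJ0 | hJ0
  · have hz : (fun x => φ x ^ qs) =ᵐ[volume] 0 :=
      (integral_eq_zero_iff_of_nonneg (fun x => Real.rpow_nonneg (hφ0 x) _) hiq).1 hJ0.symm
    have hz2 : ∫ x, φ x ^ q = 0 := by
      apply integral_eq_zero_of_ae
      filter_upwards [hz] with x hx
      have : φ x = 0 := by
        by_contra hne
        exact (Real.rpow_pos_of_pos (lt_of_le_of_ne (hφ0 x) (Ne.symm hne)) qs).ne' hx
      simp [this, Real.zero_rpow hq0.ne']
    rw [hz2, ← hJ0, Real.zero_rpow (by positivity), Real.zero_rpow (by positivity)]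
    simp
  set N : ℝ := (∫ x, φ x ^ qs) ^ (1 / qs) with hNdef
  have hN : 0 < N := by positivity
  have hNJ : N ^ qs = ∫ x, φ x ^ qs := by
    rw [hNdef, ← Real.rpow_mul hJ, one_div_mul_cancel hqs.ne', Real.rpow_one]
  have hN2 : 0 < N ^ (2:ℝ) := by positivity
  set d : ℝ := min (N ^ (2:ℝ)) s₁ with hddef
  have hd : 0 < d := lt_min hN2 hs1
  have hLd := hLpos d hd
  have hR : 0 < N * L d ^ (1 / qs) := by positivity
  have hint : ∫ x, φ x ^ q ≤ ((N * L d ^ (1 / qs)) ^ q / L d + d ^ q / L d) * K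
      + (N * L d ^ (1 / qs)) ^ (q - qs) * N ^ qs := by
    calc ∫ x, φ x ^ q ≤ ∫ x, (((N * L d ^ (1 / qs)) ^ q / L d + d ^ q / L d) * L (φ x)
          + (N * L d ^ (1 / qs)) ^ (q - qs) * φ x ^ qs) := by
          apply integral_mono_of_nonneg
          · exact Filter.Eventually.of_forall fun x => Real.rpow_nonneg (hφ0 x) _
          · exact (hiL.const_mul _).add (hiq.const_mul _)
          · exact Filter.Eventually.of_forall fun x => aux_pt L hLnonneg hLpos hLmono q qs s₁ d _
              (φ x) hq0 hqqs hm1 hd (min_le_right _ _) hR (hφ0 x)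
      _ = ((N * L d ^ (1 / qs)) ^ q / L d + d ^ q / L d) * (∫ x, L (φ x))
          + (N * L d ^ (1 / qs)) ^ (q - qs) * N ^ qs := by
          rw [integral_add (hiL.const_mul _) (hiq.const_mul _), integral_const_mul,
            integral_const_mul, hNJ]
      _ ≤ _ := by gcongr
  have hdB : d ^ (qs / 2) ≤ B * L d := by
    have := hm2 ⟨hd, min_le_right _ _⟩ ⟨hs1, le_rfl⟩ (min_le_right _ _)
    simp only at this
    rwa [div_le_iff₀ hLd] at this
  have hfin := aux_scalar q qs K N d (L d) B hq0 hqqs hK hN hd (min_le_left _ _) hLd hB hdB _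
    (integral_nonneg fun x => Real.rpow_nonneg (hφ0 x) _) hint
  have hLN := hLpos _ hN2
  have p1 : 0 < L (N ^ (2:ℝ)) ^ (-m) := by positivity
  have p2 : 0 < L s₁ ^ (-m) := by positivity
  have hle : L d ^ (-m) ≤ (1 + L s₁ ^ (-m)) * (L (N ^ (2:ℝ)) ^ (-m) + 1) := by
    rcases min_choice (N ^ (2:ℝ)) s₁ with h | h
    · rw [hddef, h]; nlinarith [mul_pos p1 p2]
    · rw [hddef, h]; nlinarith [mul_pos p1 p2]
  calc _ ≤ D * N * L d ^ (-m) := hfin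
    _ ≤ D * N * ((1 + L s₁ ^ (-m)) * (L (N ^ (2:ℝ)) ^ (-m) + 1)) := by gcongr
    _ = _ := by ring
end

section
/- Let p ≥ 1, q > 0, s₀ > 0, and let L ∈ C⁰([0,s₀]) ∩ C²((0,s₀)) be nonnegative and nondecreasing with s·L''(s) ≥ −((3p+q−2)/(p+q))·L'(s) for all s ∈ (0,s₀). Let R > 0, ε > 0, and let u ∈ C⁰(B̄_R×[0,∞)) ∩ C^{2,1}(B̄_R×(0,∞)) satisfy u_t = u^p Δu in B_R×(0,∞), u = ε on ∂B_R×(0,∞), u ≥ ε in B_R×(0,∞), and u(x,t)^{(p+q)/2} < s₀ for all (x,t) ∈ B̄_R×[0,∞). Then the function t ↦ ∫_{B_R} L(u(x,t)^{(p+q)/2}) dx is nonincreasing on [0,∞); in particular ∫_{B_R} L(u(·,t)^{(p+q)/2}) ≤ ∫_{B_R} L(u(·,0)^{(p+q)/2}) for all t > 0. -/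
open Real Set MeasureTheory Metric

/-- The Laplacian of a function on `ℝⁿ`, written via iterated Fréchet derivatives
in the coordinate directions. -/
noncomputable def lap {n : ℕ} (f : EuclideanSpace ℝ (Fin n) → ℝ)
    (x : EuclideanSpace ℝ (Fin n)) : ℝ :=
  ∑ i : Fin n, fderiv ℝ (fun y => fderiv ℝ f y (EuclideanSpace.single i 1)) x
    (EuclideanSpace.single i 1)

open Filter Topology in
lemma aux_second_deriv {f : ℝ → ℝ} (hf : ContinuousAt f 0) (hmax : IsLocalMax f 0) :
    deriv (deriv f) 0 ≤ 0 := by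
  by_contra hcon
  push Not at hcon
  have hmin := isLocalMin_of_deriv_deriv_pos hcon hmax.deriv_eq_zero hf
  have hconst : f =ᶠ[𝓝 0] fun _ => f 0 := by
    filter_upwards [hmax, hmin] with y h1 h2
    exact le_antisymm h1 h2
  have h1 := hconst.deriv.deriv_eq
  simp at h1
  linarith

lemma aux_diff_fderiv {n : ℕ} {f : EuclideanSpace ℝ (Fin n) → ℝ} {x : EuclideanSpace ℝ (Fin n)}
    (hf : ContDiffAt ℝ 2 f x) (e : EuclideanSpace ℝ (Fin n)) :
    ContDiffAt ℝ 1 (fun y => fderiv ℝ f y e) x := by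
  have h := hf.fderiv_right (m := 1) (by norm_num)
  exact h.clm_apply contDiffAt_const

open Filter Topology in
lemma aux_lap_nonpos {n : ℕ} {f : EuclideanSpace ℝ (Fin n) → ℝ} {x : EuclideanSpace ℝ (Fin n)}
    (hf : ContDiffAt ℝ 2 f x) (hmax : IsLocalMax f x) : lap f x ≤ 0 := by
  unfold lap
  refine Finset.sum_nonpos fun i _ => ?_
  set e := EuclideanSpace.single i (1:ℝ) with he
  have hline : ∀ s : ℝ, HasDerivAt (fun s : ℝ => x + s • e) e s := by
    intro s
    simpa using ((hasDerivAt_id s).smul_const e).const_add x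
  have hcont : Tendsto (fun s : ℝ => x + s • e) (𝓝 0) (𝓝 x) := by
    have := (hline 0).continuousAt.tendsto
    simpa using this
  have hev : ∀ᶠ s : ℝ in 𝓝 0, deriv (fun s : ℝ => f (x + s • e)) s = fderiv ℝ f (x + s • e) e := by
    have h1 : ∀ᶠ y in 𝓝 x, DifferentiableAt ℝ f y := by
      filter_upwards [hf.eventually (by simp)] with y hy
      exact hy.differentiableAt (by norm_num)
    filter_upwards [hcont.eventually h1] with s hs
    exact (hs.hasFDerivAt.comp_hasDerivAt s (hline s)).deriv
  have h2 : HasDerivAt (fun s : ℝ => fderiv ℝ f (x + s • e) e)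
      (fderiv ℝ (fun y => fderiv ℝ f y e) x e) 0 := by
    have hd := (aux_diff_fderiv hf e).differentiableAt (by norm_num)
    have hd' : HasFDerivAt (fun y => fderiv ℝ f y e) (fderiv ℝ (fun y => fderiv ℝ f y e) x)
      (x + (0:ℝ) • e) := by simpa using hd.hasFDerivAt
    exact hd'.comp_hasDerivAt (0:ℝ) (hline 0)
  have h3 : deriv (deriv (fun s : ℝ => f (x + s • e))) 0 =
      fderiv ℝ (fun y => fderiv ℝ f y e) x e := by
    rw [EventuallyEq.deriv_eq hev]
    exact h2.deriv
  rw [← h3]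
  apply aux_second_deriv
  · have : ContinuousAt f (x + (0:ℝ) • e) := by simpa using hf.continuousAt
    exact ContinuousAt.comp (f := fun s : ℝ => x + s • e) this (hline 0).continuousAt
  · have := hcont.eventually hmax
    filter_upwards [this] with s hs
    simpa using hs

open Filter Topology in
lemma aux_lap_lin {n : ℕ} {f g : EuclideanSpace ℝ (Fin n) → ℝ} {x : EuclideanSpace ℝ (Fin n)}
    (hf : ContDiffAt ℝ 2 f x) (hg : ContDiffAt ℝ 2 g x) (a b : ℝ) :
    lap (fun y => a * f y - b * g y) x = a * lap f x - b * lap g x := by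
  unfold lap
  rw [Finset.mul_sum, Finset.mul_sum, ← Finset.sum_sub_distrib]
  refine Finset.sum_congr rfl fun i _ => ?_
  set e := EuclideanSpace.single i (1:ℝ) with he
  have hev : (fun y => fderiv ℝ (fun y => a * f y - b * g y) y e) =ᶠ[𝓝 x]
      fun y => a * fderiv ℝ f y e - b * fderiv ℝ g y e := by
    filter_upwards [hf.eventually (by simp), hg.eventually (by simp)] with y h1 h2
    have h1 := (h1.differentiableAt (by norm_num)).hasFDerivAt
    have h2 := (h2.differentiableAt (by norm_num)).hasFDerivAt
    rw [((h1.const_mul a).fun_sub (h2.const_mul b)).fderiv]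
    simp
  rw [hev.fderiv_eq]
  have h1 := ((aux_diff_fderiv hf e).differentiableAt (by norm_num)).hasFDerivAt
  have h2 := ((aux_diff_fderiv hg e).differentiableAt (by norm_num)).hasFDerivAt
  rw [((h1.const_mul a).fun_sub (h2.const_mul b)).fderiv]
  simp

lemma aux_left_max {k : ℝ → ℝ} {k' t τ : ℝ} (htt : t < τ) (hk : HasDerivAt k k' τ)
    (hmax : ∀ s ∈ Ioo t τ, k s ≤ k τ) : 0 ≤ k' := by
  have h := (hasDerivAt_iff_tendsto_slope_left_right.1 hk).1
  refine ge_of_tendsto h ?_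
  filter_upwards [Ioo_mem_nhdsLT htt] with s hs
  rw [slope_def_field]
  exact div_nonneg_of_nonpos (by linarith [hmax s hs]) (by linarith [hs.2])

lemma aux_alg {p M A B X Y : ℝ} (hp : 1 ≤ p) (hM : 1 < M) (hB : 0 < B)
    (hAB : M * B < A) (h1 : A + p * A ^ p * X = 0) (h2 : B + p * B ^ p * Y ≤ 0)
    (h3 : X ≤ M * Y) : False := by
  have hBA : B < A := by nlinarith
  have hA : 0 < A := hB.trans hBA
  have eA : A ^ p = A * A ^ (p - 1) := by
    rw [← Real.rpow_one_add' hA.le (by linarith)]; congr 1; ring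
  have eB : B ^ p = B * B ^ (p - 1) := by
    rw [← Real.rpow_one_add' hB.le (by linarith)]; congr 1; ring
  have hle : B ^ (p-1) ≤ A ^ (p-1) := Real.rpow_le_rpow hB.le hBA.le (by linarith)
  have hb : 0 < B ^ (p-1) := Real.rpow_pos_of_pos hB _
  rw [eA] at h1
  rw [eB] at h2
  set α := A ^ (p-1)
  set β := B ^ (p-1)
  have h1' : 1 + p * α * X = 0 := by
    have : A * (1 + p * α * X) = 0 := by linarith
    rcases mul_eq_zero.1 this with h | h
    · linarith
    · exact h
  have h2' : 1 + p * β * Y ≤ 0 := by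
    by_contra hc
    push Not at hc
    nlinarith [mul_pos hB hc]
  have hp0 : 0 < p := by linarith
  have hYneg : Y < 0 := by
    by_contra hc
    push Not at hc
    have := mul_nonneg (mul_nonneg hp0.le hb.le) hc
    linarith
  have hMY : M * Y < Y := by nlinarith
  -- X < Y, so p α X < p α Y ≤ p β Y
  have hα : 0 < α := lt_of_lt_of_le hb hle
  have e1 : p * α * X < p * α * Y := mul_lt_mul_of_pos_left (by linarith) (by positivity)
  have e2 : p * α * Y ≤ p * β * Y := mul_le_mul_of_nonpos_right
    (mul_le_mul_of_nonneg_left hle hp0.le) hYneg.le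
  linarith

open Filter Topology in
/-- `t^{1/p} u(x,t)` is nondecreasing in time (time-doubling maximum principle). -/
lemma aux_mono_s4 {n : ℕ} {p R ε : ℝ} (hp : 1 ≤ p) (hε : 0 < ε)
    (u : EuclideanSpace ℝ (Fin n) → ℝ → ℝ)
    (hu_cont : ContinuousOn (fun z : (EuclideanSpace ℝ (Fin n)) × ℝ => u z.1 z.2)
      (Metric.closedBall (0 : EuclideanSpace ℝ (Fin n)) R ×ˢ Set.Ici (0:ℝ)))
    (hu_smooth : ∀ t > (0:ℝ), ContDiffOn ℝ 2 (fun y => u y t)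
      (Metric.closedBall (0 : EuclideanSpace ℝ (Fin n)) R))
    (hu_pde : ∀ x ∈ Metric.ball (0 : EuclideanSpace ℝ (Fin n)) R, ∀ t > (0:ℝ),
      HasDerivAt (fun s => u x s) (u x t ^ p * lap (fun y => u y t) x) t)
    (hu_bdry : ∀ x ∈ Metric.sphere (0 : EuclideanSpace ℝ (Fin n)) R, ∀ t > (0:ℝ), u x t = ε)
    (hu_low : ∀ x ∈ Metric.closedBall (0 : EuclideanSpace ℝ (Fin n)) R, ∀ t ≥ (0:ℝ), ε ≤ u x t)
    {M T : ℝ} (hM : 1 < M)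
    {x₀ : EuclideanSpace ℝ (Fin n)} (hx₀ : x₀ ∈ Metric.closedBall 0 R) {t₀ : ℝ} (ht₀ : 0 < t₀)
    (htT : t₀ ≤ T) :
    t₀ ^ (1/p) * u x₀ t₀ ≤ M * (T ^ (1/p) * u x₀ T) := by
  have hp0 : 0 < p := by linarith
  set K : Set (EuclideanSpace ℝ (Fin n) × (ℝ × ℝ)) :=
    (closedBall 0 R ×ˢ (Icc 0 T ×ˢ Icc 0 T)) ∩ {z | z.2.1 ≤ z.2.2} with hK
  have hKc : IsCompact K := by
    apply IsCompact.inter_right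
    · exact (isCompact_closedBall _ _).prod (isCompact_Icc.prod isCompact_Icc)
    · exact isClosed_le (by fun_prop) (by fun_prop)
  set f : EuclideanSpace ℝ (Fin n) × (ℝ × ℝ) → ℝ := fun z =>
    z.2.1 ^ (1/p) * u z.1 z.2.1 - M * (z.2.2 ^ (1/p) * u z.1 z.2.2) with hf
  have hfc : ContinuousOn f K := by
    have c1 : ContinuousOn (fun z : EuclideanSpace ℝ (Fin n) × (ℝ × ℝ) => u z.1 z.2.1) K := by
      refine hu_cont.comp (f := fun z : EuclideanSpace ℝ (Fin n) × (ℝ × ℝ) => (z.1, z.2.1))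
        (by fun_prop) ?_
      rintro ⟨x, t, τ⟩ ⟨⟨h1, h2, h3⟩, h4⟩
      exact ⟨h1, h2.1⟩
    have c2 : ContinuousOn (fun z : EuclideanSpace ℝ (Fin n) × (ℝ × ℝ) => u z.1 z.2.2) K := by
      refine hu_cont.comp (f := fun z : EuclideanSpace ℝ (Fin n) × (ℝ × ℝ) => (z.1, z.2.2))
        (by fun_prop) ?_
      rintro ⟨x, t, τ⟩ ⟨⟨h1, h2, h3⟩, h4⟩
      exact ⟨h1, h3.1⟩
    have c3 : Continuous (fun s : ℝ => s ^ (1/p)) := Real.continuous_rpow_const (by positivity)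
    have c4 : Continuous (fun z : EuclideanSpace ℝ (Fin n) × (ℝ × ℝ) => z.2.1 ^ (1/p)) :=
      c3.comp (by fun_prop)
    have c5 : Continuous (fun z : EuclideanSpace ℝ (Fin n) × (ℝ × ℝ) => z.2.2 ^ (1/p)) :=
      c3.comp (by fun_prop)
    exact (c4.continuousOn.mul c1).sub (continuousOn_const.mul (c5.continuousOn.mul c2))
  have hz₀ : (x₀, (t₀, T)) ∈ K :=
    ⟨⟨hx₀, ⟨ht₀.le, htT⟩, ⟨ht₀.le.trans htT, le_rfl⟩⟩, htT⟩
  obtain ⟨⟨x, t, τ⟩, hzK, hmax⟩ := hKc.exists_isMaxOn ⟨_, hz₀⟩ hfc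
  by_contra hcon
  push Not at hcon
  have hpos : 0 < f (x, (t, τ)) := by
    refine lt_of_lt_of_le ?_ (hmax hz₀)
    simp only [hf]
    linarith
  obtain ⟨⟨hx, ht, hτ⟩, htτ⟩ := hzK
  simp only at hx ht hτ
  replace htτ : t ≤ τ := htτ
  have hfe : f (x, (t, τ)) = t ^ (1/p) * u x t - M * (τ ^ (1/p) * u x τ) := rfl
  have hut : 0 < u x t := hε.trans_le (hu_low x hx t ht.1)
  have huτ : 0 < u x τ := hε.trans_le (hu_low x hx τ hτ.1)
  have ht0 : 0 < t := by
    rcases ht.1.eq_or_lt with h | h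
    · exfalso
      rw [hfe, ← h, Real.zero_rpow (by positivity)] at hpos
      have : 0 ≤ τ ^ (1/p) := Real.rpow_nonneg hτ.1 _
      have := mul_nonneg this huτ.le
      nlinarith
    · exact h
  have hτ0 : 0 < τ := ht0.trans_le htτ
  have hat : 0 < t ^ (1/p) := Real.rpow_pos_of_pos ht0 _
  have haτ : 0 < τ ^ (1/p) := Real.rpow_pos_of_pos hτ0 _
  have httlt : t < τ := by
    rcases htτ.eq_or_lt with h | h
    · exfalso
      rw [hfe, ← h] at hpos
      nlinarith [mul_pos hat hut]
    · exact h
  have hxb : x ∈ ball (0 : EuclideanSpace ℝ (Fin n)) R := by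
    rcases (mem_closedBall.1 hx).eq_or_lt with h | h
    · exfalso
      rw [hfe, hu_bdry x h t ht0, hu_bdry x h τ hτ0] at hpos
      have : t ^ (1/p) ≤ τ ^ (1/p) := Real.rpow_le_rpow ht0.le htτ (by positivity)
      nlinarith [mul_pos haτ hε, mul_le_mul_of_nonneg_right this hε.le]
    · exact h
  have hball : closedBall (0 : EuclideanSpace ℝ (Fin n)) R ∈ 𝓝 x :=
    mem_of_superset (isOpen_ball.mem_nhds hxb) ball_subset_closedBall
  have hs1 : ContDiffAt ℝ 2 (fun y => u y t) x := (hu_smooth t ht0).contDiffAt hball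
  have hs2 : ContDiffAt ℝ 2 (fun y => u y τ) x := (hu_smooth τ hτ0).contDiffAt hball
  have hspace : lap (fun y => t ^ (1/p) * u y t - (M * τ ^ (1/p)) * u y τ) x ≤ 0 := by
    apply aux_lap_nonpos
    · exact (contDiffAt_const.mul hs1).sub (contDiffAt_const.mul hs2)
    · filter_upwards [hball] with y hy
      have := hmax (a := (y, (t, τ))) ⟨⟨hy, ht, hτ⟩, htτ⟩
      simp only [hf, mem_ofPred_eq] at this
      linarith
  rw [aux_lap_lin hs1 hs2] at hspace
  have hder : ∀ s > 0, HasDerivAt (fun s : ℝ => s ^ (1/p) * u x s)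
      ((1/p) * s ^ (1/p - 1) * u x s + s ^ (1/p) * (u x s ^ p * lap (fun y => u y s) x)) s := by
    intro s hs
    have h1 := Real.hasDerivAt_rpow_const (x := s) (p := 1/p) (Or.inl hs.ne')
    exact h1.mul (hu_pde x hxb s hs)
  have hpow : ∀ s > (0:ℝ), s ^ (1/p - 1) = s ^ (1/p) / s := by
    intro s hs
    rw [Real.rpow_sub hs, Real.rpow_one]
  have hpp : ∀ s > (0:ℝ), (s ^ (1/p)) ^ p = s := by
    intro s hs
    rw [← Real.rpow_mul hs.le, one_div, inv_mul_cancel₀ hp0.ne', Real.rpow_one]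
  have hAp : ∀ s > 0, 0 < u x s → (s ^ (1/p) * u x s) ^ p = s * u x s ^ p := by
    intro s hs hus
    rw [Real.mul_rpow (Real.rpow_nonneg hs.le _) hus.le, hpp s hs]
  have e1 : (1/p) * t ^ (1/p - 1) * u x t +
      t ^ (1/p) * (u x t ^ p * lap (fun y => u y t) x) = 0 := by
    refine IsLocalMax.hasDerivAt_eq_zero ?_ (hder t ht0)
    filter_upwards [Ioo_mem_nhds ht0 httlt] with s hs
    have := hmax (a := (x, (s, τ))) ⟨⟨hx, ⟨hs.1.le, hs.2.le.trans hτ.2⟩, hτ⟩, hs.2.le⟩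
    simp only [hf, mem_ofPred_eq] at this
    linarith
  have e2 : 0 ≤ -((1/p) * τ ^ (1/p - 1) * u x τ +
      τ ^ (1/p) * (u x τ ^ p * lap (fun y => u y τ) x)) := by
    refine aux_left_max httlt (hder τ hτ0).neg ?_
    intro s hs
    have := hmax (a := (x, (t, s))) ⟨⟨hx, ht, ⟨ht0.le.trans hs.1.le, hs.2.le.trans hτ.2⟩⟩, hs.1.le⟩
    simp only [hf, mem_ofPred_eq] at this
    simp only [Pi.neg_apply]
    have h' : M * (τ ^ (1/p) * u x τ) ≤ M * (s ^ (1/p) * u x s) := by linarith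
    have := le_of_mul_le_mul_left h' (by linarith)
    linarith
  refine aux_alg (A := t ^ (1/p) * u x t) (B := τ ^ (1/p) * u x τ)
    (X := t ^ (1/p) * lap (fun y => u y t) x) (Y := τ ^ (1/p) * lap (fun y => u y τ) x)
    hp hM (mul_pos haτ huτ) (by rw [hfe] at hpos; linarith) ?_ ?_ (by linarith)
  · rw [hAp t ht0 hut]
    rw [hpow t ht0] at e1
    have : p * t * ((1/p) * (t ^ (1/p) / t) * u x t +
      t ^ (1/p) * (u x t ^ p * lap (fun y => u y t) x)) = 0 := by rw [e1, mul_zero]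
    rw [← this]
    field_simp
  · rw [hAp τ hτ0 huτ]
    rw [hpow τ hτ0] at e2
    have : 0 ≤ p * τ * -((1/p) * (τ ^ (1/p) / τ) * u x τ +
      τ ^ (1/p) * (u x τ ^ p * lap (fun y => u y τ) x)) := mul_nonneg (by positivity) e2
    have h' : p * τ * -((1/p) * (τ ^ (1/p) / τ) * u x τ +
      τ ^ (1/p) * (u x τ ^ p * lap (fun y => u y τ) x)) = -(τ ^ (1 / p) * u x τ + p * (τ * u x τ ^ p) * (τ ^ (1 / p) * lap (fun y => u y τ) x)) := by
      field_simp
    linarith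

/-- Aronson-Benilan type lower bound for the time derivative. -/
lemma aux_AB {n : ℕ} {p R ε : ℝ} (hp : 1 ≤ p) (hε : 0 < ε)
    (u : EuclideanSpace ℝ (Fin n) → ℝ → ℝ)
    (hu_cont : ContinuousOn (fun z : (EuclideanSpace ℝ (Fin n)) × ℝ => u z.1 z.2)
      (Metric.closedBall (0 : EuclideanSpace ℝ (Fin n)) R ×ˢ Set.Ici (0:ℝ)))
    (hu_smooth : ∀ t > (0:ℝ), ContDiffOn ℝ 2 (fun y => u y t)
      (Metric.closedBall (0 : EuclideanSpace ℝ (Fin n)) R))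
    (hu_pde : ∀ x ∈ Metric.ball (0 : EuclideanSpace ℝ (Fin n)) R, ∀ t > (0:ℝ),
      HasDerivAt (fun s => u x s) (u x t ^ p * lap (fun y => u y t) x) t)
    (hu_bdry : ∀ x ∈ Metric.sphere (0 : EuclideanSpace ℝ (Fin n)) R, ∀ t > (0:ℝ), u x t = ε)
    (hu_low : ∀ x ∈ Metric.closedBall (0 : EuclideanSpace ℝ (Fin n)) R, ∀ t ≥ (0:ℝ), ε ≤ u x t)
    {x : EuclideanSpace ℝ (Fin n)} (hx : x ∈ Metric.ball 0 R) {t : ℝ} (ht : 0 < t) :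
    - (u x t / (p * t)) ≤ u x t ^ p * lap (fun y => u y t) x := by
  have hp0 : 0 < p := by linarith
  have hmono : ∀ s ∈ Ioo 0 t, s ^ (1/p) * u x s ≤ t ^ (1/p) * u x t := by
    intro s hs
    have hB : 0 < t ^ (1/p) * u x t := mul_pos (Real.rpow_pos_of_pos ht _)
      (hε.trans_le (hu_low x (ball_subset_closedBall hx) t ht.le))
    by_contra hc
    push Not at hc
    obtain ⟨M, hM1, hM2⟩ := exists_between ((one_lt_div hB).2 hc)
    have := aux_mono_s4 hp hε u hu_cont hu_smooth hu_pde hu_bdry hu_low hM1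
      (ball_subset_closedBall hx) hs.1 hs.2.le
    rw [lt_div_iff₀ hB] at hM2
    linarith
  have h1 := Real.hasDerivAt_rpow_const (x := t) (p := 1/p) (Or.inl ht.ne')
  have h2 := aux_left_max ht (h1.mul (hu_pde x hx t ht)) hmono
  rw [Real.rpow_sub ht, Real.rpow_one] at h2
  have ha : 0 < t ^ (1/p) := Real.rpow_pos_of_pos ht _
  have h3 : 1 / p * (t ^ (1 / p) / t) * u x t + t ^ (1 / p) * (u x t ^ p * lap (fun y => u y t) x)
    = t ^ (1/p) * (u x t / (p * t) + u x t ^ p * lap (fun y => u y t) x) := by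
    field_simp
  rw [h3] at h2
  have := nonneg_of_mul_nonneg_right h2 ha
  linarith

/-- Continuity up to the boundary of the Laplacian. -/
lemma aux_lapW {n : ℕ} {R : ℝ} (hR : 0 < R) {v : EuclideanSpace ℝ (Fin n) → ℝ}
    (hv : ContDiffOn ℝ 2 v (closedBall (0 : EuclideanSpace ℝ (Fin n)) R)) :
    ∃ w : EuclideanSpace ℝ (Fin n) → ℝ, ContinuousOn w (closedBall 0 R) ∧
      ∀ x ∈ ball (0 : EuclideanSpace ℝ (Fin n)) R, lap v x = w x := by
  set Q := closedBall (0 : EuclideanSpace ℝ (Fin n)) R with hQ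
  have hU : UniqueDiffOn ℝ Q := by
    apply uniqueDiffOn_convex (convex_closedBall _ _)
    refine ⟨0, ?_⟩
    exact mem_interior_iff_mem_nhds.2 (closedBall_mem_nhds _ hR)
  have hQn : ∀ x ∈ ball (0 : EuclideanSpace ℝ (Fin n)) R, Q ∈ nhds x := fun x hx =>
    Filter.mem_of_superset (isOpen_ball.mem_nhds hx) ball_subset_closedBall
  refine ⟨fun x => ∑ i : Fin n, fderivWithin ℝ
    (fun y => fderivWithin ℝ v Q y (EuclideanSpace.single i 1)) Q x
    (EuclideanSpace.single i 1), ?_, ?_⟩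
  · refine continuousOn_finsetSum _ fun i _ => ?_
    have h1 : ContDiffOn ℝ 1 (fun y => fderivWithin ℝ v Q y (EuclideanSpace.single i 1)) Q :=
      (hv.fderivWithin hU (m := 1) (by norm_num)).clm_apply contDiffOn_const
    exact (h1.continuousOn_fderivWithin hU le_rfl).clm_apply continuousOn_const
  · intro x hx
    unfold lap
    refine Finset.sum_congr rfl fun i _ => ?_
    rw [fderivWithin_of_mem_nhds (hQn x hx)]
    have : (fun y => fderiv ℝ v y (EuclideanSpace.single i 1)) =ᶠ[nhds x]
        (fun y => fderivWithin ℝ v Q y (EuclideanSpace.single i 1)) := by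
      filter_upwards [isOpen_ball.mem_nhds hx] with y hy
      rw [fderivWithin_of_mem_nhds (hQn y hy)]
    rw [this.fderiv_eq]

lemma aux_integrable {n : ℕ} {R : ℝ} (hR : 0 < R) {v : EuclideanSpace ℝ (Fin n) → ℝ}
    (hv : ContDiffOn ℝ 2 v (closedBall (0 : EuclideanSpace ℝ (Fin n)) R))
    {S : Set ℝ} (hvS : ∀ x ∈ closedBall (0 : EuclideanSpace ℝ (Fin n)) R, v x ∈ S)
    {G : ℝ → ℝ} (hG : ContinuousOn G S) :
    IntegrableOn (fun x => G (v x) * lap v x) (ball (0 : EuclideanSpace ℝ (Fin n)) R) := by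
  obtain ⟨w, hw, hlw⟩ := aux_lapW hR hv
  have h1 : ContinuousOn (fun x => G (v x) * w x) (closedBall (0 : EuclideanSpace ℝ (Fin n)) R) :=
    (hG.comp hv.continuousOn hvS).mul hw
  have h2 := (h1.integrableOn_compact (μ := volume) (isCompact_closedBall _ _)).mono_set
    ball_subset_closedBall
  refine h2.congr_fun ?_ measurableSet_ball
  intro x hx
  simp only [hlw x hx]

lemma aux_div_zero {n : ℕ} {P : EuclideanSpace ℝ (Fin n) → ℝ} (hP : ContDiff ℝ 1 P)
    (hc : HasCompactSupport P) (e : EuclideanSpace ℝ (Fin n)) :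
    Integrable (fun x => fderiv ℝ P x e) ∧ ∫ x, fderiv ℝ P x e = 0 := by
  have hcont : Continuous (fun x => fderiv ℝ P x e) :=
    (hP.continuous_fderiv (by norm_num)).clm_apply continuous_const
  have hi : Integrable (fun x => fderiv ℝ P x e) :=
    hcont.integrable_of_hasCompactSupport (hc.fderiv_apply ℝ e)
  refine ⟨hi, ?_⟩
  have h := integral_bilinear_hasLineDerivAt_right_eq_neg_left_of_integrable
    (μ := (volume : Measure (EuclideanSpace ℝ (Fin n))))
    (f := P) (f' := fun x => fderiv ℝ P x e) (g := fun _ => (1:ℝ)) (g' := fun _ => (0:ℝ)) (v := e)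
    (B := ContinuousLinearMap.mul ℝ ℝ) (by simpa using hi) (by simp)
    (by simpa using hP.continuous.integrable_of_hasCompactSupport hc)
    (fun x _ => ((hP.differentiable (by norm_num)) x).hasFDerivAt.hasLineDerivAt e)
    (fun x _ => by simpa using (hasFDerivAt_const (1:ℝ) x).hasLineDerivAt e)
  simpa using h

open Filter Topology in
lemma aux_ibp {n : ℕ} {R ε δ : ℝ} (hR : 0 < R) (hδ : 0 < δ) {v : EuclideanSpace ℝ (Fin n) → ℝ}
    (hv : ContDiffOn ℝ 2 v (closedBall (0 : EuclideanSpace ℝ (Fin n)) R))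
    {S : Set ℝ} (hS : IsOpen S) (hvS : ∀ x ∈ closedBall (0 : EuclideanSpace ℝ (Fin n)) R, v x ∈ S)
    (hbd : ∀ x ∈ sphere (0 : EuclideanSpace ℝ (Fin n)) R, v x = ε)
    {H : ℝ → ℝ} (hH : ContDiffOn ℝ 1 H S) (hH' : ∀ r ∈ S, 0 ≤ deriv H r)
    (hH0 : ∀ r < ε + δ, H r = 0) :
    ∫ x in ball (0 : EuclideanSpace ℝ (Fin n)) R, H (v x) * lap v x ≤ 0 := by
  classical
  set B := ball (0 : EuclideanSpace ℝ (Fin n)) R with hB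
  set Q := closedBall (0 : EuclideanSpace ℝ (Fin n)) R with hQ
  set K : Set (EuclideanSpace ℝ (Fin n)) := Q ∩ v ⁻¹' (Ici (ε + δ)) with hK
  have hKcl : IsClosed K := hv.continuousOn.preimage_isClosed_of_isClosed isClosed_closedBall isClosed_Ici
  have hKc : IsCompact K := (isCompact_closedBall _ _).of_isClosed_subset hKcl inter_subset_left
  have hKB : K ⊆ B := by
    rintro x ⟨hx, hvx⟩
    rcases (mem_closedBall.1 hx).eq_or_lt with h | h
    · exfalso
      have := hbd x h
      have h2 : ε + δ ≤ v x := hvx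
      linarith
    · exact h
  have hQn : ∀ x ∈ B, Q ∈ 𝓝 x := fun x hx =>
    mem_of_superset (isOpen_ball.mem_nhds hx) ball_subset_closedBall
  have hvat : ∀ x ∈ B, ContDiffAt ℝ 2 v x := fun x hx => hv.contDiffAt (hQn x hx)
  have hHat : ∀ x ∈ B, ContDiffAt ℝ 1 H (v x) := fun x hx =>
    hH.contDiffAt (hS.mem_nhds (hvS x (ball_subset_closedBall hx)))
  set P : Fin n → EuclideanSpace ℝ (Fin n) → ℝ := fun i =>
    B.indicator (fun x => H (v x) * fderiv ℝ v x (EuclideanSpace.single i 1)) with hPdef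
  have hP0 : ∀ i, ∀ x ∉ K, P i x = 0 := by
    intro i x hx
    simp only [hPdef, indicator]
    split_ifs with hxB
    · have : v x < ε + δ := by
        by_contra hc
        push Not at hc
        exact hx ⟨ball_subset_closedBall hxB, hc⟩
      rw [hH0 _ this, zero_mul]
    · rfl
  have hPev : ∀ i, ∀ x ∈ B, P i =ᶠ[𝓝 x]
      (fun x => H (v x) * fderiv ℝ v x (EuclideanSpace.single i 1)) := by
    intro i x hx
    filter_upwards [isOpen_ball.mem_nhds hx] with y hy
    exact indicator_of_mem hy _
  have hPs : ∀ i, ContDiff ℝ 1 (P i) := by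
    intro i
    rw [contDiff_iff_contDiffAt]
    intro x
    by_cases hx : x ∈ B
    · refine ContDiffAt.congr_of_eventuallyEq ?_ (hPev i x hx)
      exact ((hHat x hx).comp x ((hvat x hx).of_le (by norm_num))).mul
        (aux_diff_fderiv (hvat x hx) _)
    · have hxK : x ∉ K := fun h => hx (hKB h)
      have : P i =ᶠ[𝓝 x] fun _ => 0 := by
        filter_upwards [hKcl.isOpen_compl.mem_nhds hxK] with y hy
        exact hP0 i y hy
      exact contDiffAt_const.congr_of_eventuallyEq this
  have hPc : ∀ i, HasCompactSupport (P i) := fun i => HasCompactSupport.intro hKc (hP0 i)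
  have hdiv := fun i => aux_div_zero (hPs i) (hPc i) (EuclideanSpace.single i 1)
  have hsumint : Integrable (fun x => ∑ i, fderiv ℝ (P i) x (EuclideanSpace.single i 1)) :=
    integrable_finsetSum _ fun i _ => (hdiv i).1
  have hsum : ∫ x, ∑ i, fderiv ℝ (P i) x (EuclideanSpace.single i 1) = 0 := by
    rw [integral_finsetSum _ fun i _ => (hdiv i).1]
    exact Finset.sum_eq_zero fun i _ => (hdiv i).2
  have hout : ∀ x ∉ B, ∑ i, fderiv ℝ (P i) x (EuclideanSpace.single i 1) = 0 := by
    intro x hx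
    refine Finset.sum_eq_zero fun i _ => ?_
    have hxK : x ∉ K := fun h => hx (hKB h)
    have : P i =ᶠ[𝓝 x] fun _ => 0 := by
      filter_upwards [hKcl.isOpen_compl.mem_nhds hxK] with y hy
      exact hP0 i y hy
    rw [this.fderiv_eq]
    simp
  rw [← hsum, ← setIntegral_eq_integral_of_forall_compl_eq_zero hout]
  refine setIntegral_mono_on (aux_integrable hR hv hvS hH.continuousOn) hsumint.integrableOn
    measurableSet_ball ?_
  intro x hx
  unfold lap
  rw [Finset.mul_sum]
  refine Finset.sum_le_sum fun i _ => ?_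
  rw [(hPev i x hx).fderiv_eq]
  have d1 : HasFDerivAt (fun x => H (v x)) (deriv H (v x) • fderiv ℝ v x) x :=
    ((hHat x hx).differentiableAt (by norm_num)).hasDerivAt.comp_hasFDerivAt x
      ((hvat x hx).differentiableAt (by norm_num)).hasFDerivAt
  have d2 := ((aux_diff_fderiv (hvat x hx) (EuclideanSpace.single i 1)).differentiableAt
    (by norm_num)).hasFDerivAt
  rw [(d1.fun_mul d2).fderiv]
  simp only [add_apply, smul_apply, smul_eq_mul]
  have := hH' (v x) (hvS x (ball_subset_closedBall hx))
  nlinarith [mul_nonneg this (mul_self_nonneg (fderiv ℝ v x (EuclideanSpace.single i 1)))]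

open Filter Topology in
lemma aux_space {n : ℕ} {R ε : ℝ} (hR : 0 < R) {v : EuclideanSpace ℝ (Fin n) → ℝ}
    (hv : ContDiffOn ℝ 2 v (closedBall (0 : EuclideanSpace ℝ (Fin n)) R))
    {S : Set ℝ} (hS : IsOpen S) (hvS : ∀ x ∈ closedBall (0 : EuclideanSpace ℝ (Fin n)) R, v x ∈ S)
    (hbd : ∀ x ∈ sphere (0 : EuclideanSpace ℝ (Fin n)) R, v x = ε)
    (hlow : ∀ x ∈ ball (0 : EuclideanSpace ℝ (Fin n)) R, ε ≤ v x)
    (hlap : ∀ x ∈ ball (0 : EuclideanSpace ℝ (Fin n)) R, v x = ε → lap v x = 0)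
    {G : ℝ → ℝ} (hG : ContDiffOn ℝ 1 G S) (hG' : ∀ r ∈ S, 0 ≤ deriv G r)
    (hG0 : ∀ r ∈ S, 0 ≤ G r) :
    ∫ x in ball (0 : EuclideanSpace ℝ (Fin n)) R, G (v x) * lap v x ≤ 0 := by
  set χ : ℕ → ℝ → ℝ := fun k r => Real.smoothTransition ((k + 1 : ℝ) * (r - ε) - 1) with hχ
  have hχs : ∀ k, ContDiff ℝ 1 (χ k) := by
    intro k
    exact (Real.smoothTransition.contDiff (n := 1)).comp (by fun_prop)
  have hχm : ∀ k, Monotone (χ k) := by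
    intro k r s hrs
    apply Real.smoothTransition.monotone
    have : (0:ℝ) ≤ k + 1 := by positivity
    nlinarith [mul_le_mul_of_nonneg_left hrs this]
  have hint := aux_integrable hR hv hvS hG.continuousOn
  have hHs : ∀ k, ContDiffOn ℝ 1 (fun r => G r * χ k r) S := fun k =>
    hG.mul (hχs k).contDiffOn
  have hk : ∀ k, ∫ x in ball (0 : EuclideanSpace ℝ (Fin n)) R,
      (fun r => G r * χ k r) (v x) * lap v x ≤ 0 := by
    intro k
    have hkpos : (0:ℝ) < k + 1 := by positivity
    refine aux_ibp (δ := 1 / (k + 1 : ℝ)) hR (by positivity) hv hS hvS hbd (hHs k) ?_ ?_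
    · intro r hr
      have h1 := ((hG.contDiffAt (hS.mem_nhds hr)).differentiableAt (by norm_num)).hasDerivAt
      have h2 := ((hχs k).differentiable (by norm_num) r).hasDerivAt
      rw [(h1.fun_mul h2).deriv]
      have : 0 ≤ deriv (χ k) r := (hχm k).deriv_nonneg
      exact add_nonneg (mul_nonneg (hG' r hr) (Real.smoothTransition.nonneg _))
        (mul_nonneg (hG0 r hr) this)
    · intro r hr
      have : χ k r = 0 := by
        apply Real.smoothTransition.zero_of_nonpos
        have : (k + 1 : ℝ) * (r - ε) < (k + 1 : ℝ) * (1 / (k+1:ℝ)) :=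
          mul_lt_mul_of_pos_left (by linarith) hkpos
        rw [mul_one_div_cancel hkpos.ne'] at this
        linarith
      rw [this, mul_zero]
  have hlim : Tendsto (fun k => ∫ x in ball (0 : EuclideanSpace ℝ (Fin n)) R,
      (fun r => G r * χ k r) (v x) * lap v x) atTop
      (𝓝 (∫ x in ball (0 : EuclideanSpace ℝ (Fin n)) R, G (v x) * lap v x)) := by
    refine tendsto_integral_of_dominated_convergence (fun x => ‖G (v x) * lap v x‖) ?_ hint.norm ?_ ?_
    · intro k
      exact (aux_integrable hR hv hvS (hHs k).continuousOn).aestronglyMeasurable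
    · intro k
      refine Eventually.of_forall fun x => ?_
      have h0 := Real.smoothTransition.nonneg ((k + 1 : ℝ) * (v x - ε) - 1)
      have h1 := Real.smoothTransition.le_one ((k + 1 : ℝ) * (v x - ε) - 1)
      simp only [hχ, norm_mul, Real.norm_eq_abs, abs_of_nonneg h0]
      calc _ ≤ |G (v x)| * 1 * |lap v x| := by gcongr
        _ = _ := by ring
    · refine (ae_restrict_iff' measurableSet_ball).2 (Eventually.of_forall fun x hx => ?_)
      rcases (hlow x hx).eq_or_lt with h | h
      · rw [hlap x hx h.symm]
        simp
      · refine tendsto_const_nhds.congr' ?_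
        obtain ⟨N, hN⟩ := exists_nat_gt (2 / (v x - ε))
        filter_upwards [eventually_ge_atTop N] with k hk
        have hpos : 0 < v x - ε := by linarith
        have : χ k (v x) = 1 := by
          apply Real.smoothTransition.one_of_one_le
          rw [div_lt_iff₀ hpos] at hN
          have hk' : (N:ℝ) ≤ k := by exact_mod_cast hk
          nlinarith
        simp [this]
  exact le_of_tendsto' hlim hk

open Filter Topology in
/-- Abstract form of the time monotonicity for positive times. -/
lemma aux_time {n : ℕ} {R : ℝ} (V W : EuclideanSpace ℝ (Fin n) → ℝ → ℝ) {t₁ t₂ C : ℝ}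
    (ht : t₁ < t₂)
    (hV : ContinuousOn (fun z : (EuclideanSpace ℝ (Fin n)) × ℝ => V z.1 z.2)
      (closedBall (0 : EuclideanSpace ℝ (Fin n)) R ×ˢ Icc t₁ (t₂ + 1)))
    (hVW : ∀ x ∈ ball (0 : EuclideanSpace ℝ (Fin n)) R, ∀ t ∈ Icc t₁ t₂,
      HasDerivAt (fun s => V x s) (W x t) t)
    (hC : ∀ x ∈ ball (0 : EuclideanSpace ℝ (Fin n)) R, ∀ t ∈ Icc t₁ t₂, -C ≤ W x t)
    (hW : ∀ t ∈ Icc t₁ t₂, ∫ x in ball (0 : EuclideanSpace ℝ (Fin n)) R, W x t ≤ 0) :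
    ∫ x in ball (0 : EuclideanSpace ℝ (Fin n)) R, V x t₂ ≤
      ∫ x in ball (0 : EuclideanSpace ℝ (Fin n)) R, V x t₁ := by
  set B := ball (0 : EuclideanSpace ℝ (Fin n)) R with hB
  set Q := closedBall (0 : EuclideanSpace ℝ (Fin n)) R with hQ
  have hBQ : B ⊆ Q := ball_subset_closedBall
  have hBfin : IsFiniteMeasure ((volume : Measure (EuclideanSpace ℝ (Fin n))).restrict B) :=
    ⟨by simpa using measure_ball_lt_top⟩
  set μ := (volume : Measure (EuclideanSpace ℝ (Fin n))).restrict B with hμ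
  set ν := (volume : Measure ℝ).restrict (Ioc t₁ t₂) with hν
  have hprod : μ.prod ν = ((volume : Measure (EuclideanSpace ℝ (Fin n))).prod volume).restrict
      (B ×ˢ Ioc t₁ t₂) := Measure.prod_restrict _ _
  have hmeasS : MeasurableSet (B ×ˢ Ioc t₁ t₂) := measurableSet_ball.prod measurableSet_Ioc
  have hVt : ∀ t ∈ Icc t₁ (t₂+1), IntegrableOn (fun x => V x t) B := by
    intro t ht
    have : ContinuousOn (fun x => V x t) Q :=
      hV.comp (f := fun x => (x, t)) (by fun_prop) (fun x hx => ⟨hx, ht⟩)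
    exact (this.integrableOn_compact (isCompact_closedBall _ _)).mono_set hBQ
  -- measurability
  have hWm : AEStronglyMeasurable (fun z : EuclideanSpace ℝ (Fin n) × ℝ => W z.1 z.2)
      (μ.prod ν) := by
    rw [hprod]
    refine aestronglyMeasurable_of_tendsto_ae atTop
      (f := fun (k : ℕ) z => (k + 1 : ℝ) * (V z.1 (z.2 + 1 / (k + 1 : ℝ)) - V z.1 z.2)) ?_ ?_
    · intro k
      refine ContinuousOn.aestronglyMeasurable ?_ hmeasS
      have hk : (0:ℝ) < 1 / (k + 1 : ℝ) := by positivity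
      have hk1 : 1 / (k + 1 : ℝ) ≤ 1 := by
        rw [div_le_one (by positivity)]
        have : (0:ℝ) ≤ k := by positivity
        linarith
      refine continuousOn_const.mul (ContinuousOn.sub ?_ ?_)
      · refine hV.comp (f := fun z : EuclideanSpace ℝ (Fin n) × ℝ => (z.1, z.2 + 1 / (k + 1 : ℝ)))
          (by fun_prop) ?_
        rintro ⟨x, t⟩ ⟨hx, h1, h2⟩
        simp only at h1 h2
        exact ⟨hBQ hx, by simp only; linarith, by simp only; linarith⟩
      · refine hV.mono ?_
        rintro ⟨x, t⟩ ⟨hx, h1, h2⟩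
        simp only at h1 h2
        exact ⟨hBQ hx, by simp only; linarith, by simp only; linarith⟩
    · refine (ae_restrict_iff' hmeasS).2 (Eventually.of_forall ?_)
      rintro ⟨x, t⟩ ⟨hx, h1, h2⟩
      have hd := hVW x hx t ⟨h1.le, h2⟩
      have hs := hd.tendsto_slope_zero_right
      have hk : Tendsto (fun k : ℕ => 1 / (k + 1 : ℝ)) atTop (𝓝[>] 0) := by
        rw [tendsto_nhdsWithin_iff]
        exact ⟨tendsto_one_div_add_atTop_nhds_zero_nat,
          Eventually.of_forall fun k => by simp only [mem_Ioi]; positivity⟩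
      have := hs.comp hk
      refine this.congr fun k => ?_
      simp
  -- time slices
  have hslice : ∀ x ∈ B, IntegrableOn (fun t => W x t + C) (Ioc t₁ t₂) ∧
      ∫ t in Ioc t₁ t₂, (W x t + C) = V x t₂ - V x t₁ + C * (t₂ - t₁) := by
    intro x hx
    have hd : ∀ t ∈ Icc t₁ t₂, HasDerivAt (fun s => V x s + C * s) (W x t + C) t := by
      intro t ht
      simpa using (hVW x hx t ht).fun_add ((hasDerivAt_id t).const_mul C)
    have hi : IntegrableOn (fun t => W x t + C) (Ioc t₁ t₂) := by
      refine intervalIntegral.integrableOn_deriv_of_nonneg (g := fun s => V x s + C * s) ?_ ?_ ?_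
      · intro t ht
        exact (hd t ht).continuousAt.continuousWithinAt
      · intro t ht
        exact hd t ⟨ht.1.le, ht.2.le⟩
      · intro t ht
        linarith [hC x hx t ⟨ht.1.le, ht.2.le⟩]
    refine ⟨hi, ?_⟩
    rw [← intervalIntegral.integral_of_le ht.le,
      intervalIntegral.integral_eq_sub_of_hasDerivAt (f := fun s => V x s + C * s)]
    · ring
    · rw [uIcc_of_le ht.le]
      exact hd
    · exact (intervalIntegrable_iff_integrableOn_Ioc_of_le ht.le).2 hi
  have hWCm : AEStronglyMeasurable (fun z : EuclideanSpace ℝ (Fin n) × ℝ => W z.1 z.2 + C)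
      (μ.prod ν) := hWm.add aestronglyMeasurable_const
  have hV1 := hVt t₁ ⟨le_rfl, by linarith⟩
  have hV2 := hVt t₂ ⟨ht.le, by linarith⟩
  have hRint : Integrable (fun x => V x t₂ - V x t₁ + C * (t₂ - t₁)) μ :=
    (hV2.sub hV1).add (integrable_const _)
  have hint : Integrable (fun z : EuclideanSpace ℝ (Fin n) × ℝ => W z.1 z.2 + C) (μ.prod ν) := by
    rw [integrable_prod_iff hWCm]
    constructor
    · exact (ae_restrict_iff' measurableSet_ball).2 (Eventually.of_forall fun x hx => (hslice x hx).1)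
    · refine hRint.congr ?_
      refine (ae_restrict_iff' measurableSet_ball).2 (Eventually.of_forall fun x hx => ?_)
      refine (hslice x hx).2.symm.trans ?_
      refine setIntegral_congr_fun measurableSet_Ioc fun t ht => ?_
      dsimp only
      rw [Real.norm_of_nonneg]
      linarith [hC x hx t ⟨ht.1.le, ht.2⟩]
  have hswap := integral_integral_swap (f := fun x t => W x t + C) hint
  have hlhs : ∫ x, ∫ t, (W x t + C) ∂ν ∂μ =
      (∫ x, V x t₂ ∂μ) - (∫ x, V x t₁ ∂μ) + ∫ _x, C * (t₂ - t₁) ∂μ := by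
    rw [← integral_sub hV2 hV1,
      ← integral_add (f := fun x => V x t₂ - V x t₁) (hV2.sub hV1) (integrable_const _)]
    exact setIntegral_congr_fun measurableSet_ball fun x hx => (hslice x hx).2
  have hνfin : IsFiniteMeasure ν := ⟨by simp [hν]⟩
  have hrhs : ∫ t, ∫ x, (W x t + C) ∂μ ∂ν ≤ ∫ _t, (∫ _x, C ∂μ) ∂ν := by
    refine integral_mono_ae hint.integral_prod_right (integrable_const _) ?_
    have h1 := hint.prod_left_ae
    have h2 : ∀ᵐ t ∂ν, t ∈ Ioc t₁ t₂ := ae_restrict_mem measurableSet_Ioc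
    filter_upwards [h1, h2] with t h1 h2
    have h3 : Integrable (fun x => W x t) μ := by
      have := h1.sub (integrable_const C)
      refine this.congr (Eventually.of_forall fun x => ?_)
      simp
    rw [integral_add h3 (integrable_const _)]
    linarith [hW t ⟨h2.1.le, h2.2⟩]
  have hconst : ∫ _t, (∫ _x, C ∂μ) ∂ν = ∫ _x, C * (t₂ - t₁) ∂μ := by
    simp only [integral_const, smul_eq_mul, hν, measureReal_restrict_apply_univ]
    rw [Real.volume_real_Ioc_of_le ht.le]
    ring
  rw [hswap] at hlhs
  linarith

/-- Properties of `G r = (d/dr) (L (r^a)) * r^p`. -/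
lemma aux_G {p q s₀ : ℝ} (hp : 1 ≤ p) (hq : 0 < q)
    {L L' L'' : ℝ → ℝ}
    (hLderiv : ∀ s ∈ Set.Ioo 0 s₀, HasDerivAt L (L' s) s)
    (hL'deriv : ∀ s ∈ Set.Ioo 0 s₀, HasDerivAt L' (L'' s) s)
    (hL''cont : ContinuousOn L'' (Set.Ioo 0 s₀))
    (hLmono : MonotoneOn L (Set.Icc 0 s₀))
    (hLconv : ∀ s ∈ Set.Ioo 0 s₀, s * L'' s ≥ -((3*p + q - 2)/(p + q)) * L' s)
    {a : ℝ} (ha : a = (p + q)/2) {S : Set ℝ} (hS : S = {r | 0 < r ∧ r ^ a < s₀}) {G : ℝ → ℝ}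
    (hG : G = fun r => L' (r ^ a) * (a * r ^ (a + p - 1))) :
    IsOpen S ∧ (∀ s ∈ Ioo 0 s₀, 0 ≤ L' s) ∧ ContDiffOn ℝ 1 G S ∧ (∀ r ∈ S, 0 ≤ G r) ∧
      (∀ r ∈ S, 0 ≤ deriv G r) := by
  have ha0 : 0 < a := by rw [ha]; linarith
  have hSo : IsOpen S := by
    rw [hS]
    exact isOpen_Ioi.inter (isOpen_Iio.preimage (Real.continuous_rpow_const ha0.le))
  have hL'0 : ∀ s ∈ Ioo 0 s₀, 0 ≤ L' s := by
    intro s hs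
    refine aux_left_max (t := 0) hs.1 (hLderiv s hs) fun r hr => ?_
    exact hLmono ⟨hr.1.le, (hr.2.trans hs.2).le⟩ ⟨hs.1.le, hs.2.le⟩ hr.2.le
  have hSI : ∀ r ∈ S, r ^ a ∈ Ioo 0 s₀ := by
    intro r hr
    rw [hS] at hr
    exact ⟨Real.rpow_pos_of_pos hr.1 _, hr.2⟩
  have hSp : ∀ r ∈ S, 0 < r := by
    intro r hr
    rw [hS] at hr
    exact hr.1
  refine ⟨hSo, hL'0, ?_, ?_, ?_⟩
  · have hL1 : ContDiffOn ℝ 1 L' (Ioo 0 s₀) := by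
      rw [show (1 : WithTop ℕ∞) = 0 + 1 by norm_num, contDiffOn_succ_iff_deriv_of_isOpen isOpen_Ioo]
      refine ⟨fun s hs => (hL'deriv s hs).differentiableAt.differentiableWithinAt, by simp, ?_⟩
      rw [contDiffOn_zero]
      exact hL''cont.congr fun s hs => (hL'deriv s hs).deriv
    have hr : ∀ b : ℝ, ContDiffOn ℝ 1 (fun r : ℝ => r ^ b) S := fun b =>
      contDiffOn_id.rpow_const_of_ne fun r hr => (hSp r hr).ne'
    rw [hG]
    exact (hL1.comp (hr a) hSI).mul (contDiffOn_const.mul (hr _))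
  · intro r hr
    rw [hG]
    exact mul_nonneg (hL'0 _ (hSI r hr)) (mul_nonneg ha0.le (Real.rpow_nonneg (hSp r hr).le _))
  · intro r hr
    have hr0 := hSp r hr
    have hs := hSI r hr
    have d1 := Real.hasDerivAt_rpow_const (x := r) (p := a) (Or.inl hr0.ne')
    have d2 := (Real.hasDerivAt_rpow_const (x := r) (p := a + p - 1) (Or.inl hr0.ne')).const_mul a
    have d3 := ((hL'deriv _ hs).comp r d1).fun_mul d2
    have d4 : HasDerivAt G _ r := hG ▸ d3
    rw [d4.deriv]
    have e1 : r ^ (a - 1) * r ^ (a + p - 1) = r ^ a * r ^ (a + p - 1 - 1) := by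
      rw [← Real.rpow_add hr0, ← Real.rpow_add hr0]; congr 1; ring
    have e2 : L'' (r ^ a) * (a * r ^ (a - 1)) * (a * r ^ (a + p - 1)) +
        (L' ∘ fun r => r ^ a) r * (a * ((a + p - 1) * r ^ (a + p - 1 - 1))) =
        a * r ^ (a + p - 1 - 1) * (a * (r ^ a * L'' (r ^ a)) + (a + p - 1) * L' (r ^ a)) := by
      simp only [Function.comp]
      linear_combination (L'' (r ^ a) * a * a) * e1
    rw [e2]
    refine mul_nonneg (mul_nonneg ha0.le (Real.rpow_nonneg hr0.le _)) ?_
    have h := mul_le_mul_of_nonneg_left (hLconv _ hs) ha0.le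
    have e3 : a * (-((3*p + q - 2)/(p + q)) * L' (r ^ a)) = - ((a + p - 1) * L' (r ^ a)) := by
      have : p + q ≠ 0 := by linarith
      rw [ha]; field_simp; ring
    linarith

open Filter Topology in
/-- Lemma 3.2 of Fila–Winkler, a Lyapunov functional.
Let `p ≥ 1`, `q > 0`, `s₀ > 0` and `L ∈ C⁰([0,s₀]) ∩ C²((0,s₀))` nonnegative,
nondecreasing with `s L''(s) ≥ -((3p+q-2)/(p+q)) L'(s)` on `(0,s₀)`.  If
`u ∈ C⁰(B̄_R×[0,∞)) ∩ C^{2,1}(B̄_R×(0,∞))` solves `u_t = u^p Δu` in `B_R×(0,∞)`,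
equals `ε` on `∂B_R×(0,∞)`, satisfies `u ≥ ε` in `B_R×(0,∞)` and
`u^{(p+q)/2} < s₀` on `B̄_R×[0,∞)`, then `t ↦ ∫_{B_R} L(u(·,t)^{(p+q)/2})` is
nonincreasing on `[0,∞)`; in particular it is dominated by its value at `t = 0`. -/
theorem stmt_4 (n : ℕ) (hn : 1 ≤ n)
    (p q s₀ : ℝ) (hp : 1 ≤ p) (hq : 0 < q) (hs₀ : 0 < s₀)
    (L L' L'' : ℝ → ℝ)
    (hLcont : ContinuousOn L (Set.Icc 0 s₀))
    (hLderiv : ∀ s ∈ Set.Ioo 0 s₀, HasDerivAt L (L' s) s)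
    (hL'deriv : ∀ s ∈ Set.Ioo 0 s₀, HasDerivAt L' (L'' s) s)
    (hL''cont : ContinuousOn L'' (Set.Ioo 0 s₀))
    (hLnonneg : ∀ s ∈ Set.Icc 0 s₀, 0 ≤ L s)
    (hLmono : MonotoneOn L (Set.Icc 0 s₀))
    (hLconv : ∀ s ∈ Set.Ioo 0 s₀, s * L'' s ≥ -((3*p + q - 2)/(p + q)) * L' s)
    (R ε : ℝ) (hR : 0 < R) (hε : 0 < ε)
    (u : EuclideanSpace ℝ (Fin n) → ℝ → ℝ)
    (hu_cont : ContinuousOn (fun z : (EuclideanSpace ℝ (Fin n)) × ℝ => u z.1 z.2)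
      (Metric.closedBall (0 : EuclideanSpace ℝ (Fin n)) R ×ˢ Set.Ici (0:ℝ)))
    (hu_smooth : ∀ t > (0:ℝ), ContDiffOn ℝ 2 (fun y => u y t)
      (Metric.closedBall (0 : EuclideanSpace ℝ (Fin n)) R))
    (hu_pde : ∀ x ∈ Metric.ball (0 : EuclideanSpace ℝ (Fin n)) R, ∀ t > (0:ℝ),
      HasDerivAt (fun s => u x s) (u x t ^ p * lap (fun y => u y t) x) t)
    (hu_bdry : ∀ x ∈ Metric.sphere (0 : EuclideanSpace ℝ (Fin n)) R, ∀ t > (0:ℝ), u x t = ε)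
    (hu_lower : ∀ x ∈ Metric.ball (0 : EuclideanSpace ℝ (Fin n)) R, ∀ t > (0:ℝ), ε ≤ u x t)
    (hu_small : ∀ x ∈ Metric.closedBall (0 : EuclideanSpace ℝ (Fin n)) R, ∀ t ≥ (0:ℝ),
      u x t ^ ((p + q)/2) < s₀) :
    AntitoneOn (fun t => ∫ x in Metric.ball (0 : EuclideanSpace ℝ (Fin n)) R,
        L (u x t ^ ((p + q)/2))) (Set.Ici 0) ∧
    ∀ t > (0:ℝ),
      (∫ x in Metric.ball (0 : EuclideanSpace ℝ (Fin n)) R, L (u x t ^ ((p + q)/2))) ≤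
      (∫ x in Metric.ball (0 : EuclideanSpace ℝ (Fin n)) R, L (u x 0 ^ ((p + q)/2))) := by
  have hp0 : 0 < p := by linarith
  set a : ℝ := (p + q)/2 with ha
  have ha0 : 0 < a := by rw [ha]; linarith
  set B := ball (0 : EuclideanSpace ℝ (Fin n)) R with hB
  set Q := closedBall (0 : EuclideanSpace ℝ (Fin n)) R with hQ
  have hBQ : B ⊆ Q := ball_subset_closedBall
  obtain ⟨S, hS⟩ : ∃ S : Set ℝ, S = {r | 0 < r ∧ r ^ a < s₀} := ⟨_, rfl⟩
  obtain ⟨G, hG⟩ : ∃ G : ℝ → ℝ, G = fun r => L' (r ^ a) * (a * r ^ (a + p - 1)) := ⟨_, rfl⟩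
  obtain ⟨hSo, hL'0, hGs, hG0, hG'⟩ :=
    aux_G hp hq hLderiv hL'deriv hL''cont hLmono hLconv ha hS hG
  -- lower bound everywhere
  have hlow : ∀ x ∈ Q, ∀ t ≥ (0:ℝ), ε ≤ u x t := by
    have hpos : ∀ x ∈ Q, ∀ t > (0:ℝ), ε ≤ u x t := by
      intro x hx t ht
      rcases (mem_closedBall.1 hx).eq_or_lt with h | h
      · exact (hu_bdry x h t ht).ge
      · exact hu_lower x h t ht
    intro x hx t ht
    have hc : ContinuousWithinAt (fun s => u x s) (Ici 0) t :=
      (hu_cont.comp (f := fun s : ℝ => (x, s)) (s := Ici 0) (by fun_prop)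
        (fun s hs => ⟨hx, hs⟩)) t ht
    have hc' : Tendsto (fun s => u x s) (𝓝[>] t) (𝓝 (u x t)) :=
      hc.mono (fun s hs => mem_Ici.2 (le_trans ht (le_of_lt hs)))
    refine ge_of_tendsto hc' ?_
    filter_upwards [self_mem_nhdsWithin] with s hs
    exact hpos x hx s (lt_of_le_of_lt ht hs)
  have hupos : ∀ x ∈ Q, ∀ t ≥ (0:ℝ), 0 < u x t := fun x hx t ht => hε.trans_le (hlow x hx t ht)
  have huS : ∀ x ∈ Q, ∀ t ≥ (0:ℝ), u x t ∈ S := by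
    intro x hx t ht
    rw [hS]
    exact ⟨hupos x hx t ht, hu_small x hx t ht⟩
  have huI : ∀ x ∈ Q, ∀ t ≥ (0:ℝ), u x t ^ a ∈ Ioo 0 s₀ := fun x hx t ht =>
    ⟨Real.rpow_pos_of_pos (hupos x hx t ht) _, hu_small x hx t ht⟩
  have hpowc : ContinuousOn (fun z : (EuclideanSpace ℝ (Fin n)) × ℝ => u z.1 z.2 ^ a)
      (Q ×ˢ Ici (0:ℝ)) := (Real.continuous_rpow_const ha0.le).comp_continuousOn hu_cont
  have hVc : ContinuousOn (fun z : (EuclideanSpace ℝ (Fin n)) × ℝ => L (u z.1 z.2 ^ a))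
      (Q ×ˢ Ici (0:ℝ)) := by
    refine hLcont.comp hpowc ?_
    rintro ⟨x, t⟩ ⟨hx, ht⟩
    exact Ioo_subset_Icc_self (huI x hx t ht)
  -- monotonicity for positive times
  have hmain : ∀ t₁ t₂ : ℝ, 0 < t₁ → t₁ < t₂ →
      ∫ x in B, L (u x t₂ ^ a) ≤ ∫ x in B, L (u x t₁ ^ a) := by
    intro t₁ t₂ h1 h12
    have hsub : Q ×ˢ Icc t₁ t₂ ⊆ Q ×ˢ Ici (0:ℝ) :=
      prod_mono le_rfl (fun t ht => h1.le.trans ht.1)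
    have hDc : ContinuousOn (fun z : (EuclideanSpace ℝ (Fin n)) × ℝ =>
        (L' (u z.1 z.2 ^ a) * (a * u z.1 z.2 ^ (a - 1))) * (u z.1 z.2 / (p * z.2)))
        (Q ×ˢ Icc t₁ t₂) := by
      have c0 := hu_cont.mono hsub
      have hL'c : ContinuousOn L' (Ioo 0 s₀) := fun s hs =>
        (hL'deriv s hs).continuousAt.continuousWithinAt
      have c1 : ContinuousOn (fun z : (EuclideanSpace ℝ (Fin n)) × ℝ => L' (u z.1 z.2 ^ a))
          (Q ×ˢ Icc t₁ t₂) := by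
        refine hL'c.comp (hpowc.mono hsub) ?_
        rintro ⟨x, t⟩ ⟨hx, ht⟩
        exact huI x hx t (h1.le.trans ht.1)
      have c2 : ContinuousOn (fun z : (EuclideanSpace ℝ (Fin n)) × ℝ => u z.1 z.2 ^ (a - 1))
          (Q ×ˢ Icc t₁ t₂) := by
        refine c0.rpow_const ?_
        rintro ⟨x, t⟩ ⟨hx, ht⟩
        exact Or.inl (hupos x hx t (h1.le.trans ht.1)).ne'
      refine (c1.mul (continuousOn_const.mul c2)).mul (c0.div (by fun_prop) ?_)
      rintro ⟨x, t⟩ ⟨hx, ht⟩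
      have : 0 < t := h1.trans_le ht.1
      simp only
      positivity
    obtain ⟨C, hC⟩ := ((isCompact_closedBall _ _).prod isCompact_Icc).bddAbove_image hDc
    have hC' : ∀ x ∈ Q, ∀ t ∈ Icc t₁ t₂,
        (L' (u x t ^ a) * (a * u x t ^ (a - 1))) * (u x t / (p * t)) ≤ C :=
      fun x hx t ht => hC ⟨(x, t), ⟨hx, ht⟩, rfl⟩
    have hWe : ∀ x ∈ Q, ∀ t ≥ (0:ℝ), G (u x t) * lap (fun y => u y t) x =
        (L' (u x t ^ a) * (a * u x t ^ (a - 1))) * (u x t ^ p * lap (fun y => u y t) x) := by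
      intro x hx t ht
      have : u x t ^ (a + p - 1) = u x t ^ (a - 1) * u x t ^ p := by
        rw [← Real.rpow_add (hupos x hx t ht)]; congr 1; ring
      rw [hG]
      simp only [this]
      ring
    refine aux_time (C := C) (fun x t => L (u x t ^ a))
      (fun x t => G (u x t) * lap (fun y => u y t) x) h12
      (hVc.mono (prod_mono le_rfl (fun t ht => h1.le.trans ht.1))) ?_ ?_ ?_
    · intro x hx t ht
      have ht0 : 0 < t := h1.trans_le ht.1
      rw [hWe x (hBQ hx) t ht0.le]
      have d1 := Real.hasDerivAt_rpow_const (x := u x t) (p := a)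
        (Or.inl (hupos x (hBQ hx) t ht0.le).ne')
      have d2 := (hLderiv _ (huI x (hBQ hx) t ht0.le)).comp (u x t) d1
      exact d2.comp t (hu_pde x hx t ht0)
    · intro x hx t ht
      have ht0 : 0 < t := h1.trans_le ht.1
      rw [hWe x (hBQ hx) t ht0.le]
      have hAB := aux_AB hp hε u hu_cont hu_smooth hu_pde hu_bdry hlow hx ht0
      have hD : 0 ≤ L' (u x t ^ a) * (a * u x t ^ (a - 1)) :=
        mul_nonneg (hL'0 _ (huI x (hBQ hx) t ht0.le))
          (mul_nonneg ha0.le (Real.rpow_nonneg (hupos x (hBQ hx) t ht0.le).le _))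
      have := mul_le_mul_of_nonneg_left hAB hD
      linarith [hC' x (hBQ hx) t ht]
    · intro t ht
      have ht0 : 0 < t := h1.trans_le ht.1
      refine aux_space hR (hu_smooth t ht0) hSo (fun x hx => huS x hx t ht0.le)
        (fun x hx => hu_bdry x hx t ht0) (fun x hx => hu_lower x hx t ht0) ?_ hGs hG' hG0
      intro x hx hux
      have hmin : IsLocalMin (fun s => u x s) t := by
        filter_upwards [Ioi_mem_nhds ht0] with s hs
        exact hux.le.trans (hu_lower x hx s hs)
      have h0 := hmin.hasDerivAt_eq_zero (hu_pde x hx t ht0)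
      rcases mul_eq_zero.1 h0 with h | h
      · exact absurd h (Real.rpow_pos_of_pos (hupos x (hBQ hx) t ht0.le) _).ne'
      · exact h
  -- continuity at time zero
  have hBfin : IsFiniteMeasure ((volume : Measure (EuclideanSpace ℝ (Fin n))).restrict B) :=
    ⟨by simpa using measure_ball_lt_top⟩
  have hEc : ContinuousOn (fun t => ∫ x in B, L (u x t ^ a)) (Icc 0 1) := by
    have hVc1 : ContinuousOn (fun z : (EuclideanSpace ℝ (Fin n)) × ℝ => L (u z.1 z.2 ^ a))
      (Q ×ˢ Icc (0:ℝ) 1) := hVc.mono (prod_mono le_rfl (fun t ht => ht.1))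
    obtain ⟨C, hC⟩ := ((isCompact_closedBall _ _).prod isCompact_Icc).exists_bound_of_continuousOn hVc1
    refine continuousOn_of_dominated (bound := fun _ => C) ?_ ?_ (integrable_const C) ?_
    · intro t ht
      refine ContinuousOn.aestronglyMeasurable ?_ measurableSet_ball
      exact hVc1.comp (f := fun x => (x, t)) (by fun_prop) (fun x hx => ⟨hBQ hx, ht⟩)
    · intro t ht
      exact (ae_restrict_iff' measurableSet_ball).2
        (Eventually.of_forall fun x hx => hC (x, t) ⟨hBQ hx, ht⟩)
    · refine (ae_restrict_iff' measurableSet_ball).2 (Eventually.of_forall fun x hx => ?_)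
      exact hVc1.comp (f := fun t => (x, t)) (by fun_prop) (fun t ht => ⟨hBQ hx, ht⟩)
  have hzero : ∀ t > (0:ℝ), ∫ x in B, L (u x t ^ a) ≤ ∫ x in B, L (u x 0 ^ a) := by
    intro t ht
    have h0 : ContinuousWithinAt (fun t => ∫ x in B, L (u x t ^ a)) (Icc 0 1) 0 :=
      hEc 0 ⟨le_rfl, zero_le_one⟩
    have h1 : Tendsto (fun t => ∫ x in B, L (u x t ^ a)) (𝓝[Ioc 0 1] 0)
        (𝓝 (∫ x in B, L (u x 0 ^ a))) := h0.mono Ioc_subset_Icc_self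
    rw [nhdsWithin_Ioc_eq_nhdsGT zero_lt_one] at h1
    refine ge_of_tendsto h1 ?_
    filter_upwards [Ioo_mem_nhdsGT ht] with s hs
    exact hmain s t hs.1 hs.2
  refine ⟨?_, hzero⟩
  intro t₁ h1 t₂ h2 h12
  rcases h12.eq_or_lt with h | h
  · rw [h]
  · rcases (mem_Ici.1 h1).eq_or_lt with h' | h'
    · subst h'
      exact hzero t₂ h
    · exact hmain t₁ t₂ h' h
end

section
/- Let L ∈ C⁰([0,∞)) ∩ C¹((0,∞)) be nondecreasing, nonnegative, positive on (0,∞), and satisfy hypothesis (H) for some s₀>0 with constants a>0 and λ₀>0. Let β > 1/(1+λ₀), γ > 0 and δ₀ > 0. Then there exists C > 0 such that: whenever η > 0 and δ ∈ (0,δ₀] satisfy η^β · L(η)^γ ≤ δ, it follows that η ≤ C · δ^{1/β} · L(δ)^{−γ/β}. -/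
open Real Set

/-- Lemma 2.7 of Fila–Winkler.
Let `L ∈ C⁰([0,∞)) ∩ C¹((0,∞))` be nondecreasing, nonnegative, positive on `(0,∞)`,
satisfying hypothesis (H) with constants `a, λ₀`.  For `β > 1/(1+λ₀)`, `γ > 0`, `δ₀ > 0`
there is `C > 0` such that `η^β L(η)^γ ≤ δ` with `δ ∈ (0,δ₀]` implies
`η ≤ C δ^{1/β} L(δ)^{-γ/β}`. -/
theorem stmt_5 (L L' : ℝ → ℝ)
    (hLcont : ContinuousOn L (Set.Ici 0))
    (hLderiv : ∀ s ∈ Set.Ioi (0:ℝ), HasDerivAt L (L' s) s)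
    (hL'cont : ContinuousOn L' (Set.Ioi 0))
    (hLmono : MonotoneOn L (Set.Ici 0))
    (hLnonneg : ∀ s ∈ Set.Ici (0:ℝ), 0 ≤ L s)
    (hLpos : ∀ s ∈ Set.Ioi (0:ℝ), 0 < L s)
    (s₀ : ℝ) (hs₀ : 0 < s₀)
    (a lam₀ : ℝ) (ha : 0 < a) (hlam₀ : 0 < lam₀)
    (hH : ∀ s ∈ Set.Ioo 0 s₀, ∀ l ∈ Set.Ioo 0 lam₀,
      L s ≤ (1 + a * l) * L (s ^ (1 + l)))
    (β γ δ₀ : ℝ) (hβ : 1 / (1 + lam₀) < β) (hγ : 0 < γ) (hδ₀ : 0 < δ₀) :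
    ∃ C > 0, ∀ η δ : ℝ, 0 < η → 0 < δ → δ ≤ δ₀ →
      η ^ β * L η ^ γ ≤ δ →
      η ≤ C * δ ^ (1 / β) * L δ ^ (-(γ / β)) := by
  have hβ0 : 0 < β := lt_trans (by positivity) hβ
  -- choose an exponent
  obtain ⟨l, hl0, hl1, hlβ⟩ : ∃ l : ℝ, 0 < l ∧ l < lam₀ ∧ 1 ≤ (1 + l) * β := by
    refine ⟨max (lam₀ / 2) (1 / β - 1), lt_max_of_lt_left (by positivity), ?_, ?_⟩
    · refine max_lt (by linarith) ?_
      have h1 : 1 < β * (1 + lam₀) := by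
        rwa [div_lt_iff₀ (by positivity)] at hβ
      have h2 : 1 / β < 1 + lam₀ := by
        rw [div_lt_iff₀ hβ0]; linarith
      linarith
    · have h1 : 1 / β ≤ 1 + max (lam₀ / 2) (1 / β - 1) := by
        have := le_max_right (lam₀ / 2) (1 / β - 1)
        linarith
      rwa [div_le_iff₀ hβ0] at h1
  have hLd0 : 0 < L δ₀ := hLpos δ₀ hδ₀
  set s1 : ℝ := min s₀ 1 with hs1
  have hs1pos : 0 < s1 := lt_min hs₀ one_pos
  have hal : 0 < 1 + a * l := by positivity
  set A : ℝ := (1 + a * l) ^ γ with hA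
  set B : ℝ := L δ₀ ^ γ with hB
  set D : ℝ := δ₀ ^ β * B / s1 with hD
  have hA0 : 0 < A := by positivity
  have hB0 : 0 < B := by positivity
  have hD0 : 0 < D := by positivity
  set M : ℝ := 1 + A + B + D with hM
  have hM0 : 0 < M := by positivity
  have key : ∀ η δ : ℝ, 0 < η → 0 < δ → δ ≤ δ₀ →
      η ^ β * L η ^ γ ≤ δ → η ^ β * L δ ^ γ ≤ M * δ := by
    intro η δ hη hδ hδδ h
    have hηβ : 0 < η ^ β := by positivity
    have hLδ := hLpos δ hδ
    have hLη := hLpos η hη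
    have hLB : L δ ^ γ ≤ B :=
      rpow_le_rpow hLδ.le (hLmono (mem_Ici.2 hδ.le) (mem_Ici.2 hδ₀.le) hδδ) hγ.le
    by_cases h1 : δ ≤ η
    · have h2 : L δ ^ γ ≤ L η ^ γ :=
        rpow_le_rpow hLδ.le (hLmono (mem_Ici.2 hδ.le) (mem_Ici.2 hη.le) h1) hγ.le
      calc η ^ β * L δ ^ γ ≤ η ^ β * L η ^ γ := by gcongr
        _ ≤ 1 * δ := by linarith
        _ ≤ M * δ := by gcongr; linarith
    push Not at h1
    by_cases h2 : s1 ≤ δ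
    · calc η ^ β * L δ ^ γ ≤ δ₀ ^ β * B := by
            have : η ^ β ≤ δ₀ ^ β := rpow_le_rpow hη.le (by linarith) hβ0.le
            gcongr
        _ = D * s1 := by rw [hD]; field_simp
        _ ≤ M * δ := by
            have : D ≤ M := by linarith
            gcongr
    push Not at h2
    have hd1 : δ < 1 := lt_of_lt_of_le h2 (min_le_right _ _)
    have hds : δ < s₀ := lt_of_lt_of_le h2 (min_le_left _ _)
    by_cases h3 : η ≤ δ ^ (1 + l)
    · have h4 : η ^ β ≤ δ := by
        calc η ^ β ≤ (δ ^ (1 + l)) ^ β := rpow_le_rpow hη.le h3 hβ0.le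
          _ = δ ^ ((1 + l) * β) := (rpow_mul hδ.le _ _).symm
          _ ≤ δ ^ (1 : ℝ) := rpow_le_rpow_of_exponent_ge hδ hd1.le hlβ
          _ = δ := rpow_one δ
      calc η ^ β * L δ ^ γ ≤ δ * B := by gcongr
        _ = B * δ := mul_comm _ _
        _ ≤ M * δ := by gcongr; linarith
    push Not at h3
    have h4 : L δ ≤ (1 + a * l) * L η := by
      refine (hH δ ⟨hδ, hds⟩ l ⟨hl0, hl1⟩).trans ?_
      have : L (δ ^ (1 + l)) ≤ L η :=
        hLmono (mem_Ici.2 (by positivity)) (mem_Ici.2 hη.le) h3.le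
      gcongr
    have h5 : L δ ^ γ ≤ A * L η ^ γ := by
      rw [hA, ← mul_rpow hal.le hLη.le]
      exact rpow_le_rpow hLδ.le h4 hγ.le
    calc η ^ β * L δ ^ γ ≤ η ^ β * (A * L η ^ γ) := by gcongr
      _ = A * (η ^ β * L η ^ γ) := by ring
      _ ≤ A * δ := by gcongr
      _ ≤ M * δ := by gcongr; linarith
  refine ⟨M ^ (1 / β), by positivity, ?_⟩
  intro η δ hη hδ hδδ h
  have hLδ := hLpos δ hδ
  have h1 := key η δ hη hδ hδδ h
  have h2 : η ^ β ≤ M * δ * L δ ^ (-γ) := by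
    rw [rpow_neg hLδ.le, ← div_eq_mul_inv, le_div_iff₀ (by positivity)]
    exact h1
  have h3 : (η ^ β) ^ (1 / β) ≤ (M * δ * L δ ^ (-γ)) ^ (1 / β) :=
    rpow_le_rpow (by positivity) h2 (by positivity)
  rw [← rpow_mul hη.le, mul_one_div_cancel hβ0.ne', rpow_one,
    mul_rpow (by positivity) (by positivity), mul_rpow hM0.le hδ.le, ← rpow_mul hLδ.le] at h3
  have h4 : -γ * (1 / β) = -(γ / β) := by ring
  rwa [h4] at h3
end
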